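/- **Setting.** A data schema $\mathcal D$ consists of a catalog (read-only relations with a single-column primary key, whose types are pairwise different, and foreign keys), a repository (updatable relations) and finitely many typed case variables, among them $\mathsf{self}$. A DAB $\mathcal M=\langle\mathcal D,\mathcal P\rangle$ adds a block-structured BPMN process $\mathcal P$ with conditions and update specifications over $\mathcal D$; the lifecycle state of each block is a further (control) case variable. Its array-based translation is the relational artifact system (RAS) $\mathcal S$ given as follows. The DB signature $\Sigma$ has the types of $\mathcal D$ and a sort of control values as sorts, a constant $\mathtt{undef}$ in each sort, the constant objects in use, and a unary function $f_{R,A}$ from the key sort of $R$ to the sort of $A$ for each non-key attribute $A$ of each catalog relation $R$; $\Sigma$ is *acyclic* if the graph on sorts with an edge $s\to t$ for each $f:s\to t$ has no directed cycle. The DB theory $T$ consists of the axioms $\forall x\,(x=\mathtt{undef}\leftrightarrow f(x)=\mathtt{undef})$, and $T^*$ is its model completion. There is one artifact sort of case indexes with an array $v[\cdot]$ for each (data or control) case variable $v$, and one artifact sort for each repository relation $R$ with an array $a_{R_k}[\cdot]$ for each attribute of $R$. The transition relation $\tau$ of $\mathcal S$ is the disjunction of the transition formulae translating the control-flow rules of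 the blocks and of those translating the update specifications, with multiset insertion (the *update transitions*). **Strong locality.** A state formula is *strongly local* if it is a disjunction of formulae $\exists e_1\cdots\exists e_k\,(\delta(e_1,\dots,e_k)\wedge\psi(\underline x)\wedge\bigwedge_{i=1}^k\phi_i(e_i,\underline a))$, where the $e_i$ are variables of artifact sorts, $\delta$ is a conjunction of equalities and inequalities among them, $\psi$ is quantifier-free over the artifact variables $\underline x$, and each $\phi_i$ is quantifier-free over the arrays $\underline a$ and mentions only $e_i$. A transition formula $\hat\tau$ is strongly local if for every strongly local $\phi$ the preimage $\mathit{Pre}(\hat\tau,\phi)$ is equivalent, modulo $T^*$, to a strongly local formula. **Queries.** A property over $n$ cases of $\mathcal M$ is a conjunction $\bigwedge_{i<n}G_i[i]$ of guards $G_i=(q_i(\vec x)\leftarrow\bigvee_j Q_{ij})$, each with its own variables, where each $Q_{ij}$ is a conjunction of equalities, inequalities and positive or negated catalog and repository atoms, and every non-case variable of $G_i$ also occurs in a repository atom of $G_i$. It is *separated* if, for each $i$, the $Q_{ij}$ pairwise share no non-case variables and each $Q_{ij}$ has the form $\chi\wedge R(\vec y)\wedge\xi$ (each part optional), where $\chi$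 and $\xi$ do not query the repository, $R$ is a repository relation, no case variable occurs in $\vec y$ or $\xi$, and no non-case variable of $\chi$ occurs in $\vec y$ or $\xi$. The array-based translation of a property existentially quantifies pairwise different case indexes, replaces each case variable $v$ of $G_i$ by the read $v[i]$, each repository atom $R(t_1,\dots,t_m)$ by $\bigwedge_k a_{R_k}[e]=t_k$ for a fresh existentially quantified $e$, each catalog atom $R(t_0,\dots,t_m)$ by $t_0\neq\mathtt{undef}\wedge\bigwedge_k t_k=f_{R,A_k}(t_0)$, eliminates the quantifier of each non-case variable $y$ with a definition $y=a_{R_k}[e]$, and distributes $\wedge$ over $\vee$. **Backward reachability** on a state formula $\upsilon$ starts with $\phi=\upsilon$, $B=\bot$. While $\phi\wedge\neg B$ is $T$-satisfiable, it returns *unsafe* if $\iota\wedge\phi$ is $T$-satisfiable, where $\iota$ is the initial formula of $\mathcal S$, and otherwise it replaces $B$ by $\phi\vee B$ and $\phi$ by a state formula that is equivalent to $\mathit{Pre}(\tau,\phi)$ modulo $T^*$, as delivered by a quantifier elimination procedure. When the loop ends, it returns *safe*. **Statement.** Let $\mathcal M$ be a DAB and let $P$ be a separated property over cases of $\mathcal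 M$. Then the array-based translation of $P$ is a strongly local state formula of $\mathcal S$. If, moreover, the translated DB signature $\Sigma$ is acyclic and all update transitions of $\mathcal S$ are strongly local, then backward reachability on $\mathcal S$ and the translation of $P$ terminates, whatever quantifier elimination procedure is used. -/

import Mathlib

namespace DAB

/-! ### DB signatures, terms, structures, and the DB theory of undefined values -/

/-- A DB signature: a finite multi-sorted signature with equality, unary function symbols
(`Fn s t` are the symbols `s ⟶ t`) and constants, among them `undef` in every sort. -/
structure DBSig where
  Srt : Type
  Fn : Srt → Srt → Type
  Cn : Srt → Type
  undef : ∀ s, Cn s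
  finSrt : Finite Srt
  finFn : Finite (Σ s t, Fn s t)
  finCn : Finite (Σ s, Cn s)

/-- The characteristic graph of the signature: an edge `s ⟶ t` for each `f : s ⟶ t`. -/
def DBSig.Edge (S : DBSig) (s t : S.Srt) : Prop := Nonempty (S.Fn s t)

/-- The characteristic graph has no directed cycle (loops included). -/
def DBSig.Acyclic (S : DBSig) : Prop := ∀ s, ¬ Relation.TransGen S.Edge s s

/-- Well-sorted terms over variables `V`. -/
inductive Term (S : DBSig) (V : S.Srt → Type) : S.Srt → Type
  | var {s : S.Srt} (v : V s) : Term S V s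
  | cst {s : S.Srt} (c : S.Cn s) : Term S V s
  | app {s t : S.Srt} (f : S.Fn s t) (u : Term S V s) : Term S V t

/-- Every variable of the term satisfies `P`. -/
def Term.All {S : DBSig} {V : S.Srt → Type} (P : ∀ s, V s → Prop) :
    {s : S.Srt} → Term S V s → Prop
  | _, .var v => P _ v
  | _, .cst _ => True
  | _, .app _ u => u.All P

structure DBStr (S : DBSig) where
  car : S.Srt → Type
  fn : ∀ {s t : S.Srt}, S.Fn s t → car s → car t
  cn : ∀ {s : S.Srt}, S.Cn s → car s

def Term.eval {S : DBSig} {V : S.Srt → Type} (M : DBStr S) (v : ∀ s, V s → M.car s) :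
    {s : S.Srt} → Term S V s → M.car s
  | _, .var x => v _ x
  | _, .cst c => M.cn c
  | _, .app f u => M.fn f (u.eval M v)

/-- Models of the DB theory `T`, which consists of the axioms
`∀ x (x = undef ↔ f(x) = undef)`, one for each function symbol `f`. -/
def DBStr.IsDBModel {S : DBSig} (M : DBStr S) : Prop :=
  ∀ (s t : S.Srt) (f : S.Fn s t) (x : M.car s),
    x = M.cn (S.undef s) ↔ M.fn f x = M.cn (S.undef t)

/-! ### First-order formulae and the model completion `T*` -/

/-- First-order formulae over a DB signature; the variables of each sort are named by `ℕ`. -/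
inductive FO (S : DBSig) : Type
  | eq {s : S.Srt} (t u : Term S (fun _ => ℕ) s) : FO S
  | neg (φ : FO S) : FO S
  | and (φ ψ : FO S) : FO S
  | all (s : S.Srt) (n : ℕ) (φ : FO S) : FO S

open Classical in
def FO.Holds {S : DBSig} (M : DBStr S) : FO S → (∀ s, ℕ → M.car s) → Prop
  | .eq t u, v => t.eval M v = u.eval M v
  | .neg φ, v => ¬ φ.Holds M v
  | .and φ ψ, v => φ.Holds M v ∧ ψ.Holds M v
  | .all s n φ, v =>
      ∀ x : M.car s, φ.Holds M (Function.update v s (Function.update (v s) n x))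

def FO.QuantifierFree {S : DBSig} : FO S → Prop
  | .eq _ _ => True
  | .neg φ => φ.QuantifierFree
  | .and φ ψ => φ.QuantifierFree ∧ ψ.QuantifierFree
  | .all _ _ _ => False

/-- `M` is a model of `Th`; free variables are read as universally quantified. -/
def DBStr.Models {S : DBSig} (M : DBStr S) (Th : Set (FO S)) : Prop :=
  ∀ φ ∈ Th, ∀ v, φ.Holds M v

structure DBStr.Embedding {S : DBSig} (M N : DBStr S) where
  map : ∀ s, M.car s → N.car s
  inj : ∀ s, Function.Injective (map s)
  map_fn : ∀ {s t : S.Srt} (f : S.Fn s t) (x : M.car s), map t (M.fn f x) = N.fn f (map s x)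
  map_cn : ∀ {s : S.Srt} (c : S.Cn s), map s (M.cn c) = N.cn c

/-- `Tstar` is a model completion of the (universal) DB theory `T`: it extends `T`, every model
of `T` embeds into a model of `Tstar`, and `Tstar` eliminates quantifiers. -/
structure IsModelCompletion (S : DBSig) (Tstar : Set (FO S)) : Prop where
  extends_T : ∀ M : DBStr S, M.Models Tstar → M.IsDBModel
  embeds : ∀ M : DBStr S, M.IsDBModel →
    ∃ N : DBStr S, N.Models Tstar ∧ Nonempty (M.Embedding N)
  qe : ∀ φ : FO S, ∃ ψ : FO S, ψ.QuantifierFree ∧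
    ∀ M : DBStr S, M.Models Tstar → ∀ v, ψ.Holds M v ↔ φ.Holds M v

/-! ### Artifact settings and formulae over them -/

/-- A DB signature, an artifact extension of it (the sorts `ASort`), and an artifact setting
`(x, a)`: artifact variables `AVar s` of basic sort `s`, artifact components `Comp E s`
(arrays with source the artifact sort `E` and target the basic sort `s`). -/
structure Setting where
  sig : DBSig
  ASort : Type
  AVar : sig.Srt → Type
  Comp : ASort → sig.Srt → Type
  finASort : Finite ASort
  finAVar : Finite (Σ s, AVar s)
  finComp : Finite (Σ E s, Comp E s)

/-- The atomic references of basic sort `s`: an artifact variable, an individual variable of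
sort `s` (named by a number), or the read `a[e]` of an array at the individual variable `e` of
artifact sort (`read a n` is the read at the variable with name `n` of the source sort). -/
inductive Ref (A : Setting) : A.sig.Srt → Type
  | avar {s : A.sig.Srt} (x : A.AVar s) : Ref A s
  | bvar {s : A.sig.Srt} (n : ℕ) : Ref A s
  | read {E : A.ASort} {s : A.sig.Srt} (a : A.Comp E s) (n : ℕ) : Ref A s

abbrev ATerm (A : Setting) (s : A.sig.Srt) : Type := Term A.sig (Ref A) s

/-- Quantifier-free formulae; `aeq E n m` is the equality of the variables `n`, `m` of
artifact sort `E`. -/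
inductive QF (A : Setting) : Type
  | tru : QF A
  | eq {s : A.sig.Srt} (t u : ATerm A s) : QF A
  | aeq (E : A.ASort) (n m : ℕ) : QF A
  | neg (φ : QF A) : QF A
  | and (φ ψ : QF A) : QF A

def QF.or {A : Setting} (φ ψ : QF A) : QF A := .neg (.and (.neg φ) (.neg ψ))

def QF.conj {A : Setting} : List (QF A) → QF A
  | [] => .tru
  | φ :: l => .and φ (QF.conj l)

def QF.disj {A : Setting} : List (QF A) → QF A
  | [] => .neg .tru
  | φ :: l => .or φ (QF.disj l)

/-- Every reference in the formula satisfies `P`, every variable of artifact sort compared in an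
equality `aeq` satisfies `Q`. -/
def QF.All {A : Setting} (P : ∀ s, Ref A s → Prop) (Q : A.ASort → ℕ → Prop) : QF A → Prop
  | .tru => True
  | .eq t u => t.All P ∧ u.All P
  | .aeq E n m => Q E n ∧ Q E m
  | .neg φ => φ.All P Q
  | .and φ ψ => φ.All P Q ∧ ψ.All P Q

/-- Case-defined terms, as nested if-then-else expressions. -/
inductive CTerm (A : Setting) (s : A.sig.Srt) : Type
  | tm (t : ATerm A s) : CTerm A s
  | ite (c : QF A) (t e : CTerm A s) : CTerm A s

/-- An existential formula in disjunctive form: each disjunct is the existential closure, over all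
individual variables occurring in it, of the conjunction of a list of quantifier-free formulae. -/
abbrev EFormula (A : Setting) : Type := List (List (QF A))

/-- `c` contains no individual variable of basic sort. -/
def QF.NoBasicVar {A : Setting} (c : QF A) : Prop :=
  c.All (fun s r => ∀ n, r ≠ (.bvar n : Ref A s)) (fun _ _ => True)

/-- A state formula `∃ e φ(e, x, a)` (or a disjunction of such): only variables of artifact sort are
quantified. -/
def IsState {A : Setting} (φ : EFormula A) : Prop := ∀ d ∈ φ, ∀ c ∈ d, c.NoBasicVar

/-- `c` is an equality or an inequality between variables of artifact sort. -/
def QF.IsDelta {A : Setting} (c : QF A) : Prop :=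
  ∃ E n m, c = .aeq E n m ∨ c = .neg (.aeq E n m)

/-- `c` is a formula `ψ(x)`: only artifact variables and constants. -/
def QF.OnlyAVars {A : Setting} (c : QF A) : Prop :=
  c.All (fun s r => ∃ x : A.AVar s, r = .avar x) (fun _ _ => False)

/-- `c` is a formula `φ(e, a)` where `e` is the variable `n` of artifact sort `E`: every array is
read at `e`, and neither artifact variables nor other individual variables occur. -/
def QF.OnlyEntry {A : Setting} (E : A.ASort) (n : ℕ) (c : QF A) : Prop :=
  c.All (fun s r => ∃ a : A.Comp E s, r = .read a n) (fun E' n' => E' = E ∧ n' = n)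

/-- Strongly local state formulae: disjunctions of formulae
`∃ e₁ … e_k (δ(e₁, …, e_k) ∧ ψ(x) ∧ ⋀ᵢ φᵢ(eᵢ, a))`. The conjunction is a list, so its conjuncts come
in any order and the conjuncts of `δ`, `ψ` and each `φᵢ` may be listed separately. -/
def StronglyLocal {A : Setting} (φ : EFormula A) : Prop :=
  IsState φ ∧ ∀ d ∈ φ, ∀ c ∈ d, c.IsDelta ∨ c.OnlyAVars ∨ ∃ E n, c.OnlyEntry E n

/-! ### Semantics -/

/-- A structure for the artifact extension. -/
structure Str (A : Setting) where
  base : DBStr A.sig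
  art : A.ASort → Type
  art_nonempty : ∀ E, Nonempty (art E)

/-- An assignment to the artifact setting. -/
structure Asg {A : Setting} (M : Str A) where
  x : ∀ {s : A.sig.Srt}, A.AVar s → M.base.car s
  a : ∀ {E : A.ASort} {s : A.sig.Srt}, A.Comp E s → M.art E → M.base.car s

/-- Values of the individual variables of artifact sort, respectively of basic sort. -/
abbrev AEnv {A : Setting} (M : Str A) : Type := ∀ E : A.ASort, ℕ → M.art E
abbrev BEnv {A : Setting} (M : Str A) : Type := ∀ s : A.sig.Srt, ℕ → M.base.car s

def Ref.eval {A : Setting} {M : Str A} (α : Asg M) (ρ : AEnv M) (v : BEnv M) :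
    (s : A.sig.Srt) → Ref A s → M.base.car s
  | _, .avar x => α.x x
  | s, .bvar n => v s n
  | _, .read (E := E) a n => α.a a (ρ E n)

def QF.Holds {A : Setting} {M : Str A} (α : Asg M) (ρ : AEnv M) (v : BEnv M) : QF A → Prop
  | .tru => True
  | .eq t u => t.eval M.base (Ref.eval α ρ v) = u.eval M.base (Ref.eval α ρ v)
  | .aeq E n m => ρ E n = ρ E m
  | .neg φ => ¬ φ.Holds α ρ v
  | .and φ ψ => φ.Holds α ρ v ∧ ψ.Holds α ρ v

open Classical in
noncomputable def CTerm.eval {A : Setting} {M : Str A} (α : Asg M) (ρ : AEnv M) (v : BEnv M)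
    {s : A.sig.Srt} : CTerm A s → M.base.car s
  | .tm t => t.eval M.base (Ref.eval α ρ v)
  | .ite c t e => if c.Holds α ρ v then t.eval α ρ v else e.eval α ρ v

def EFormula.Holds {A : Setting} {M : Str A} (φ : EFormula A) (α : Asg M) : Prop :=
  ∃ d ∈ φ, ∃ (ρ : AEnv M) (v : BEnv M), ∀ c ∈ d, c.Holds α ρ v

/-! ### Relational artifact systems and backward reachability -/

/-- A transition formula
`∃ e (γ(e, x, a) ∧ ⋀ᵢ x'ᵢ = Fᵢ(e, x, a) ∧ ⋀ⱼ a'ⱼ = λ y. Gⱼ(y, e, x, a))`. In `Gⱼ` the bound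
variable `y` is the variable with name `0` of the source sort of `aⱼ` (so that the variable `0` among
the `e` of that sort is not accessible there). -/
structure Trans (A : Setting) where
  guard : List (QF A)
  updX : ∀ {s : A.sig.Srt}, A.AVar s → CTerm A s
  updA : ∀ {E : A.ASort} {s : A.sig.Srt}, A.Comp E s → CTerm A s

open Classical in
/-- Binding `y` to the variable `0` of sort `E`. -/
noncomputable def AEnv.bind {A : Setting} {M : Str A} (ρ : AEnv M) (E : A.ASort) (y : M.art E) :
    AEnv M :=
  Function.update ρ E (Function.update (ρ E) 0 y)

def Trans.Holds {A : Setting} {M : Str A} (τ : Trans A) (α α' : Asg M) : Prop :=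
  ∃ (ρ : AEnv M) (v : BEnv M), (∀ c ∈ τ.guard, c.Holds α ρ v) ∧
    (∀ (s : A.sig.Srt) (x : A.AVar s), α'.x x = (τ.updX x).eval α ρ v) ∧
    (∀ (E : A.ASort) (s : A.sig.Srt) (a : A.Comp E s) (y : M.art E),
      α'.a a y = (τ.updA a).eval α (ρ.bind E y) v)

/-- A relational artifact system over the DB theory `T`: the initial formula is
`⋀ᵢ xᵢ = cᵢ ∧ ⋀ⱼ aⱼ = λ y. dⱼ`, and the transition relation is the disjunction of `trans`. -/
structure RAS where
  A : Setting
  iniX : ∀ {s : A.sig.Srt}, A.AVar s → A.sig.Cn s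
  iniA : ∀ {E : A.ASort} {s : A.sig.Srt}, A.Comp E s → A.sig.Cn s
  trans : List (Trans A)

def RAS.Initial (S : RAS) {M : Str S.A} (α : Asg M) : Prop :=
  (∀ (s : S.A.sig.Srt) (x : S.A.AVar s), α.x x = M.base.cn (S.iniX x)) ∧
  (∀ (E : S.A.ASort) (s : S.A.sig.Srt) (a : S.A.Comp E s) (y : M.art E),
    α.a a y = M.base.cn (S.iniA a))

/-- `Pre(τ, φ) = ∃ x' a' (τ(x, a, x', a') ∧ φ(x', a'))`, for `τ` the disjunction of `ts`. -/
def Pre {A : Setting} (ts : List (Trans A)) (φ : EFormula A) {M : Str A} (α : Asg M) : Prop :=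
  ∃ α' : Asg M, (∃ τ ∈ ts, τ.Holds α α') ∧ φ.Holds α'

/-- `φ` is equivalent to `Pre(τ, ψ)` modulo the axioms of `Tstar`. -/
def IsPreMod {A : Setting} (Tstar : Set (FO A.sig)) (ts : List (Trans A)) (ψ φ : EFormula A) :
    Prop :=
  ∀ M : Str A, M.base.Models Tstar → ∀ α : Asg M, φ.Holds α ↔ Pre ts ψ α

/-- A strongly local transition formula: the preimage of every strongly local formula is strongly
local, modulo the axioms of `Tstar`. -/
def StronglyLocalTrans {A : Setting} (Tstar : Set (FO A.sig)) (τ : Trans A) : Prop :=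
  ∀ ψ : EFormula A, StronglyLocal ψ → ∃ φ : EFormula A, StronglyLocal φ ∧ IsPreMod Tstar [τ] ψ φ

/-- `T`-satisfiability. -/
def TSat {A : Setting} (P : ∀ {M : Str A}, Asg M → Prop) : Prop :=
  ∃ M : Str A, M.base.IsDBModel ∧ ∃ α : Asg M, P α

/-- `QE ∘ Pre`: `preQE φ` is a state formula obtained from `Pre(τ, φ)` by eliminating, modulo
`Tstar`, the quantifiers over basic sorts. -/
def IsPreQE (S : RAS) (Tstar : Set (FO S.A.sig)) (preQE : EFormula S.A → EFormula S.A) : Prop :=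
  ∀ φ, IsState φ → IsState (preQE φ) ∧ IsPreMod Tstar S.trans φ (preQE φ)

/-- The while loop of backward reachability halts when it is entered with the values `φ` and `B`:
it exits (`safe`) if `φ ∧ ¬B` is `T`-unsatisfiable; otherwise it returns `unsafe` if `ι ∧ φ` is
`T`-satisfiable; otherwise `B ← φ ∨ B`, `φ ← QE(Tstar, Pre(τ, φ))`, and the loop is entered again. -/
inductive LoopHalts (S : RAS) (preQE : EFormula S.A → EFormula S.A) :
    EFormula S.A → EFormula S.A → Prop
  | safe {φ B : EFormula S.A} (h : ¬ TSat fun {_} α => φ.Holds α ∧ ¬ B.Holds α) :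
      LoopHalts S preQE φ B
  | unsafety {φ B : EFormula S.A} (h : TSat fun {_} α => φ.Holds α ∧ ¬ B.Holds α)
      (hi : TSat fun {_} α => S.Initial α ∧ φ.Holds α) : LoopHalts S preQE φ B
  | loop {φ B : EFormula S.A} (h : TSat fun {_} α => φ.Holds α ∧ ¬ B.Holds α)
      (hi : ¬ TSat fun {_} α => S.Initial α ∧ φ.Holds α)
      (hl : LoopHalts S preQE (preQE φ) (φ ++ B)) : LoopHalts S preQE φ B

/-- Backward reachability terminates on `υ`, whatever quantifier elimination procedure is used. -/
def BackReachTerminates (S : RAS) (Tstar : Set (FO S.A.sig)) (υ : EFormula S.A) : Prop :=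
  ∀ preQE, IsPreQE S Tstar preQE → LoopHalts S preQE υ []

/-! ### Data schemas and their translation -/

/-- A data schema. `Ty` are the types in use, `Obj t` the constant objects of type `t` in use (other
than `undef`). A catalog relation `R` has the primary key type `pk R` and the further attributes
`catAttr R k`. -/
structure DataSchema where
  Ty : Type
  isId : Ty → Prop
  Obj : Ty → Type
  Cat : Type
  pk : Cat → Ty
  catAr : Cat → ℕ
  catAttr : ∀ R : Cat, Fin (catAr R) → Ty
  CType : Ty
  Repo : Type
  repoAr : Repo → ℕ
  repoAttr : ∀ R : Repo, Fin (repoAr R) → Ty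
  CVar : Type
  cvTy : CVar → Ty
  self : CVar
  finTy : Finite Ty
  finObj : Finite (Σ t, Obj t)
  finCat : Finite Cat
  finRepo : Finite Repo
  finCVar : Finite CVar
  pk_id : ∀ R, isId (pk R)
  pk_inj : Function.Injective pk
  cat_fk : ∀ R k, isId (catAttr R k) → ∃ R₂, pk R₂ = catAttr R k
  ctype_id : isId CType
  ctype_ne : ∀ R, pk R ≠ CType
  repo_pos : ∀ R, 0 < repoAr R
  repo_fk : ∀ R k, isId (repoAttr R k) → (∃ R₂, pk R₂ = repoAttr R k) ∨ repoAttr R k = CType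
  cvar_fk : ∀ x, isId (cvTy x) → (∃ R₂, pk R₂ = cvTy x) ∨ cvTy x = CType
  self_ty : cvTy self = CType

/-- Values of the control variables: lifecycle states, and truth values for error flags. -/
inductive Life : Type
  | idle | enabled | active | completed | waiting | waiting1 | waiting2 | error | tt | ff

/-- Basic sorts of the translation: the types of the schema and the sort of control values. -/
inductive BSort (D : DataSchema) : Type
  | data (t : D.Ty) : BSort D
  | ctrl : BSort D

inductive BConst (D : DataSchema) : BSort D → Type
  | undef (s : BSort D) : BConst D s
  | obj {t : D.Ty} (c : D.Obj t) : BConst D (.data t)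
  | life (l : Life) : BConst D .ctrl

/-- The function symbols `f_{R,A}`, from the sort of the primary key of `R` to that of `A`. -/
inductive CatFn (D : DataSchema) : BSort D → BSort D → Type
  | mk (R : D.Cat) (k : Fin (D.catAr R)) : CatFn D (.data (D.pk R)) (.data (D.catAttr R k))

theorem finite_life : Finite Life :=
  Finite.of_surjective
    (fun i : Fin 10 => (![Life.idle, .enabled, .active, .completed, .waiting, .waiting1,
      .waiting2, .error, .tt, .ff] : Fin 10 → Life) i) (by
      intro l
      cases l
      exacts [⟨0, rfl⟩, ⟨1, rfl⟩, ⟨2, rfl⟩, ⟨3, rfl⟩, ⟨4, rfl⟩, ⟨5, rfl⟩, ⟨6, rfl⟩, ⟨7, rfl⟩,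
        ⟨8, rfl⟩, ⟨9, rfl⟩])

theorem finite_bsort (D : DataSchema) : Finite (BSort D) := by
  have := D.finTy
  refine Finite.of_surjective (fun o : Option D.Ty => o.elim BSort.ctrl BSort.data) ?_
  rintro (t | _)
  exacts [⟨some t, rfl⟩, ⟨none, rfl⟩]

theorem finite_bconst (D : DataSchema) : Finite (Σ s, BConst D s) := by
  have := finite_bsort D
  have := D.finObj
  have := finite_life
  let f : BSort D ⊕ (Σ t, D.Obj t) ⊕ Life → Σ s, BConst D s := fun
    | .inl s => ⟨s, .undef s⟩
    | .inr (.inl p) => ⟨_, .obj p.2⟩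
    | .inr (.inr l) => ⟨_, .life l⟩
  refine Finite.of_surjective f ?_
  rintro ⟨_, s | ⟨c⟩ | l⟩
  exacts [⟨.inl _, rfl⟩, ⟨.inr (.inl ⟨_, c⟩), rfl⟩, ⟨.inr (.inr l), rfl⟩]

theorem finite_catFn (D : DataSchema) : Finite (Σ s t, CatFn D s t) := by
  have := D.finCat
  let f : (Σ R : D.Cat, Fin (D.catAr R)) → Σ s t, CatFn D s t := fun p => ⟨_, _, .mk p.1 p.2⟩
  refine Finite.of_surjective f ?_
  rintro ⟨_, _, ⟨R, k⟩⟩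
  exact ⟨⟨R, k⟩, rfl⟩

/-- The DB signature translating the catalog. -/
abbrev DataSchema.sig (D : DataSchema) : DBSig where
  Srt := BSort D
  Fn := CatFn D
  Cn := BConst D
  undef := BConst.undef
  finSrt := finite_bsort D
  finFn := finite_catFn D
  finCn := finite_bconst D

/-- Control variables: the lifecycle state of a block, and the error flag of a block. -/
inductive Ctrl (B : Type) : Type
  | life (b : B) : Ctrl B
  | err (b : B) : Ctrl B

/-- Artifact sorts: the sort of case indexes, and one sort for each repository relation. -/
inductive ASrt (D : DataSchema) : Type
  | pi : ASrt D
  | repo (R : D.Repo) : ASrt D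

/-- Artifact components: one array for each case variable, control variable, and attribute of a
repository relation. -/
inductive DComp (D : DataSchema) (B : Type) : ASrt D → BSort D → Type
  | cv (x : D.CVar) : DComp D B .pi (.data (D.cvTy x))
  | ctl (c : Ctrl B) : DComp D B .pi .ctrl
  | rep (R : D.Repo) (k : Fin (D.repoAr R)) : DComp D B (.repo R) (.data (D.repoAttr R k))

theorem finite_asrt (D : DataSchema) : Finite (ASrt D) := by
  have := D.finRepo
  refine Finite.of_surjective (fun o : Option D.Repo => o.elim ASrt.pi ASrt.repo) ?_
  rintro (_ | R)
  exacts [⟨none, rfl⟩, ⟨some R, rfl⟩]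

theorem finite_dcomp (D : DataSchema) (B : Type) [Finite B] : Finite (Σ E s, DComp D B E s) := by
  have := D.finRepo
  have := D.finCVar
  let f : D.CVar ⊕ B ⊕ B ⊕ (Σ R : D.Repo, Fin (D.repoAr R)) → Σ E s, DComp D B E s := fun
    | .inl x => ⟨_, _, .cv x⟩
    | .inr (.inl b) => ⟨_, _, .ctl (.life b)⟩
    | .inr (.inr (.inl b)) => ⟨_, _, .ctl (.err b)⟩
    | .inr (.inr (.inr p)) => ⟨_, _, .rep p.1 p.2⟩
  refine Finite.of_surjective f ?_
  rintro ⟨_, _, x | (b | b) | ⟨R, k⟩⟩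
  exacts [⟨.inl x, rfl⟩, ⟨.inr (.inl b), rfl⟩, ⟨.inr (.inr (.inl b)), rfl⟩,
    ⟨.inr (.inr (.inr ⟨R, k⟩)), rfl⟩]

/-- The artifact setting of the translation; all its data are arrays, there are no artifact
variables. -/
abbrev DataSchema.setting (D : DataSchema) (B : Type) [Finite B] : Setting where
  sig := D.sig
  ASort := ASrt D
  AVar := fun _ => Empty
  Comp := DComp D B
  finASort := finite_asrt D
  finAVar := by have := finite_bsort D; exact inferInstance
  finComp := finite_dcomp D B

/-! ### Queries -/

/-- Terms of queries: typed variables (of each type named by `ℕ`), case variables (data or control),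
constants. -/
inductive QTerm (D : DataSchema) (B : Type) : BSort D → Type
  | var {t : D.Ty} (n : ℕ) : QTerm D B (.data t)
  | cvar {s : BSort D} (c : DComp D B .pi s) : QTerm D B s
  | cst {s : BSort D} (c : BConst D s) : QTerm D B s

/-- A tuple of terms for a repository relation. -/
structure RepoAtom (D : DataSchema) (B : Type) where
  rel : D.Repo
  arg : ∀ k, QTerm D B (.data (D.repoAttr rel k))

structure CatAtom (D : DataSchema) (B : Type) where
  rel : D.Cat
  key : QTerm D B (.data (D.pk rel))
  arg : ∀ k, QTerm D B (.data (D.catAttr rel k))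

/-- Conditions. -/
inductive Cond (D : DataSchema) (B : Type) : Type
  | eq {s : BSort D} (t u : QTerm D B s) : Cond D B
  | neg (φ : Cond D B) : Cond D B
  | and (φ ψ : Cond D B) : Cond D B

/-- Literals of conjunctive queries with filters. -/
inductive Lit (D : DataSchema) (B : Type) : Type
  | eq {s : BSort D} (t u : QTerm D B s) : Lit D B
  | ne {s : BSort D} (t u : QTerm D B s) : Lit D B
  | cat (a : CatAtom D B) : Lit D B
  | ncat (a : CatAtom D B) : Lit D B
  | rep (a : RepoAtom D B) : Lit D B
  | nrep (a : RepoAtom D B) : Lit D B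

/-- A conjunctive query with filters, as the list of its conjuncts. -/
abbrev CQ (D : DataSchema) (B : Type) : Type := List (Lit D B)

section
variable {D : DataSchema} {B : Type}

/-- The non-case variables of a term, as pairs (type, name). -/
def QTerm.vars : {s : BSort D} → QTerm D B s → Set (D.Ty × ℕ)
  | _, .var (t := t) n => {(t, n)}
  | _, .cvar _ => ∅
  | _, .cst _ => ∅

def QTerm.CaseFree : {s : BSort D} → QTerm D B s → Prop
  | _, .cvar _ => False
  | _, .var _ => True
  | _, .cst _ => True

def RepoAtom.vars (a : RepoAtom D B) : Set (D.Ty × ℕ) := ⋃ k, (a.arg k).vars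

def CatAtom.vars (a : CatAtom D B) : Set (D.Ty × ℕ) := a.key.vars ∪ ⋃ k, (a.arg k).vars

def Lit.vars : Lit D B → Set (D.Ty × ℕ)
  | .eq t u => t.vars ∪ u.vars
  | .ne t u => t.vars ∪ u.vars
  | .cat a => a.vars
  | .ncat a => a.vars
  | .rep a => a.vars
  | .nrep a => a.vars

def CQ.vars (Q : CQ D B) : Set (D.Ty × ℕ) := {x | ∃ l ∈ Q, x ∈ l.vars}

def RepoAtom.CaseFree (a : RepoAtom D B) : Prop := ∀ k, (a.arg k).CaseFree

/-- No case variable occurs in the literal. -/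
def Lit.CaseFree : Lit D B → Prop
  | .eq t u => t.CaseFree ∧ u.CaseFree
  | .ne t u => t.CaseFree ∧ u.CaseFree
  | .cat a => a.key.CaseFree ∧ ∀ k, (a.arg k).CaseFree
  | .ncat a => a.key.CaseFree ∧ ∀ k, (a.arg k).CaseFree
  | .rep a => a.CaseFree
  | .nrep a => a.CaseFree

/-- The variables of the literal if it queries a repository relation. -/
def Lit.repoVars : Lit D B → Set (D.Ty × ℕ)
  | .rep a => a.vars
  | .nrep a => a.vars
  | _ => ∅

/-- The literal does not query the repository. -/
def Lit.RepoFree : Lit D B → Prop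
  | .rep _ => False
  | .nrep _ => False
  | _ => True

/-- The query is over the catalog only. -/
def CQ.RepoFree (Q : CQ D B) : Prop := ∀ l ∈ Q, l.RepoFree

end

/-- A guard `q(x) ← ⋁ᵢ Qᵢ`. -/
structure Guard (D : DataSchema) (B : Type) where
  head : List (D.Ty × ℕ)
  disjuncts : List (CQ D B)
  head_sub : ∀ Q ∈ disjuncts, ∀ x ∈ head, x ∈ CQ.vars Q

/-- Separated guards: distinct disjuncts share no non-case variables, and each disjunct is (up to the
order of its conjuncts) of the form `χ ∧ R(y) ∧ ξ`, where the atom `R(y)` is optional, and so are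
`χ` and `ξ` (they may be empty). -/
def Guard.Separated {D : DataSchema} {B : Type} (G : Guard D B) : Prop :=
  G.disjuncts.Pairwise (fun Q Q' => Disjoint (CQ.vars Q) (CQ.vars Q')) ∧
  ∀ Q ∈ G.disjuncts, ∃ (χ : CQ D B) (r : Option (RepoAtom D B)) (ξ : CQ D B),
    Q.Perm (χ ++ r.toList.map Lit.rep ++ ξ) ∧
    χ.RepoFree ∧
    (∀ a ∈ r, a.CaseFree ∧ Disjoint χ.vars a.vars) ∧
    ξ.RepoFree ∧ (∀ l ∈ ξ, l.CaseFree) ∧ Disjoint χ.vars ξ.vars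

/-! ### Updates and blocks -/

/-- The right-hand side of a conditional update of `R`: a row or a nested if-then-else, whose filters
are disjunctions of conjunctive queries. -/
inductive CTree (D : DataSchema) (B : Type) (R : D.Repo) : Type
  | row (u : ∀ k, QTerm D B (.data (D.repoAttr R k))) : CTree D B R
  | ite (ψ : List (CQ D B)) (t e : CTree D B R) : CTree D B R

/-- Assignments `SET x₁ = v₁, …`; the variables sent to `none` keep their value. -/
abbrev SetPart (D : DataSchema) (B : Type) : Type :=
  ∀ x : D.CVar, Option (QTerm D B (.data (D.cvTy x)))

/-- Effect rules: (insert and) set, delete and set, conditional update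
`UPDATE R(v) IF … THEN … ELSE …`. -/
inductive Effect (D : DataSchema) (B : Type) : Type
  | insertSet (ins : Option (RepoAtom D B)) (set : SetPart D B) : Effect D B
  | deleteSet (u : RepoAtom D B) (set : SetPart D B) : Effect D B
  | condUpd (R : D.Repo) (v : Fin (D.repoAr R) → ℕ) (f : CTree D B R) : Effect D B

section
variable {D : DataSchema} {B : Type}

def CTree.vars {R : D.Repo} : CTree D B R → Set (D.Ty × ℕ)
  | .row u => ⋃ k, (u k).vars
  | .ite ψ t e => {x | ∃ Q ∈ ψ, x ∈ CQ.vars Q} ∪ t.vars ∪ e.vars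

def CTree.RepoFree {R : D.Repo} : CTree D B R → Prop
  | .row _ => True
  | .ite ψ t e => (∀ Q ∈ ψ, CQ.RepoFree Q) ∧ t.RepoFree ∧ e.RepoFree

/-- The variable `self` is not set, and the values are taken from the variables `hd`. -/
def SetPart.WF (set : SetPart D B) (hd : List (D.Ty × ℕ)) : Prop :=
  set D.self = none ∧ ∀ x, ∀ u ∈ set x, ∀ y ∈ u.vars, y ∈ hd

/-- Well-formedness of an effect under a precondition with answer variables `hd`. -/
def Effect.WF (hd : List (D.Ty × ℕ)) : Effect D B → Prop
  | .insertSet ins set => (∀ a ∈ ins, ∀ y ∈ a.vars, y ∈ hd) ∧ set.WF hd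
  | .deleteSet u set => (∀ y ∈ u.vars, y ∈ hd) ∧ set.WF hd
  | .condUpd R v f =>
      Function.Injective (fun k => (D.repoAttr R k, v k)) ∧
      (∀ k, (D.repoAttr R k, v k) ∉ hd) ∧ f.RepoFree ∧
      ∀ y ∈ f.vars, y ∈ hd ∨ ∃ k, y = (D.repoAttr R k, v k)

/-- The effect does not touch the repository. -/
def Effect.SetOnly : Effect D B → Prop
  | .insertSet ins _ => ins = none
  | .deleteSet _ _ => False
  | .condUpd _ _ _ => False

end

/-- Update specifications. -/
structure UpdSpec (D : DataSchema) (B : Type) where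
  pre : Guard D B
  eff : Effect D B
  wf : eff.WF pre.head

inductive LeafKind (D : DataSchema) (B : Type) : Type
  | empty : LeafKind D B
  | task (atomic : Bool) (u : UpdSpec D B) : LeafKind D B
  | event (u : UpdSpec D B) : LeafKind D B

/-- Blocks with one nested block: root blocks with the updates of their start and end events,
subprocesses, and possible completion with an error caught at the boundary of the block `hand`. -/
inductive UnKind (D : DataSchema) (B : Type) : Type
  | proc (es et : UpdSpec D B) : UnKind D B
  | subproc : UnKind D B
  | possErr (φ : Cond D B) (hand : B) : UnKind D B

inductive BinKind (D : DataSchema) (B : Type) : Type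
  | seq : BinKind D B
  | par : BinKind D B
  | orChoice (φ₁ φ₂ : Cond D B) : BinKind D B
  | choice (φ : Cond D B) : BinKind D B
  | defChoice : BinKind D B
  | loop (φ : Cond D B) : BinKind D B
  | backExc : BinKind D B

inductive TerKind : Type
  | fwdExc | nonInt

/-- Blocks of block-structured BPMN, with names in `B`. `four` is the event-driven choice between
the events `E₁`, `E₂`, followed by `B₁`, respectively `B₂`. -/
inductive Block (D : DataSchema) (B : Type) : Type
  | leaf (b : B) (k : LeafKind D B) : Block D B
  | one (b : B) (k : UnKind D B) (B₁ : Block D B) : Block D B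
  | two (b : B) (k : BinKind D B) (B₁ B₂ : Block D B) : Block D B
  | three (b : B) (k : TerKind) (A B₁ B₂ : Block D B) : Block D B
  | four (b : B) (E₁ E₂ B₁ B₂ : Block D B) : Block D B

section
variable {D : DataSchema} {B : Type}

def Block.name : Block D B → B
  | .leaf b _ => b
  | .one b _ _ => b
  | .two b _ _ _ => b
  | .three b _ _ _ _ => b
  | .four b _ _ _ _ => b

/-- The names of the block and of all its descendants. -/
def Block.names : Block D B → List B
  | .leaf b _ => [b]
  | .one b _ B₁ => b :: B₁.names
  | .two b _ B₁ B₂ => b :: (B₁.names ++ B₂.names)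
  | .three b _ A B₁ B₂ => b :: (A.names ++ B₁.names ++ B₂.names)
  | .four b E₁ E₂ B₁ B₂ => b :: (E₁.names ++ E₂.names ++ B₁.names ++ B₂.names)

/-- The names of the proper descendants of the block. -/
def Block.subNames (X : Block D B) : List B := X.names.tail

open Classical in
/-- The names of the proper descendants of the descendant named `b`. -/
noncomputable def Block.subsOf (b : B) : Block D B → List B
  | .leaf _ _ => []
  | .one b' _ B₁ => if b' = b then B₁.names else B₁.subsOf b
  | .two b' _ B₁ B₂ => if b' = b then B₁.names ++ B₂.names else B₁.subsOf b ++ B₂.subsOf b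
  | .three b' _ A B₁ B₂ =>
      if b' = b then A.names ++ B₁.names ++ B₂.names
      else A.subsOf b ++ B₁.subsOf b ++ B₂.subsOf b
  | .four b' E₁ E₂ B₁ B₂ =>
      if b' = b then E₁.names ++ E₂.names ++ B₁.names ++ B₂.names
      else E₁.subsOf b ++ E₂.subsOf b ++ B₁.subsOf b ++ B₂.subsOf b

def Block.IsProc : Block D B → Prop
  | .one _ (.proc _ _) _ => True
  | _ => False

def Block.IsSubproc : Block D B → Prop
  | .one _ .subproc _ => True
  | _ => False

def Block.IsEvent : Block D B → Prop
  | .leaf _ (.event _) => True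
  | _ => False

def LeafKind.WF : LeafKind D B → Prop
  | .task false u => u.eff.SetOnly
  | _ => True

def UnKind.WF (hs : List B) (B₁ : Block D B) : UnKind D B → Prop
  | .proc _ _ => True
  | .subproc => B₁.IsProc
  | .possErr _ hand => hand ∈ hs

/-- Well-formedness of a block nested in subprocesses, with an interrupting exception handler, whose
names are `hs`. -/
def Block.WF (hs : List B) : Block D B → Prop
  | .leaf _ k => k.WF
  | .one _ k B₁ => k.WF hs B₁ ∧ B₁.WF hs
  | .two _ .backExc A B₁ => A.IsSubproc ∧ A.WF (A.name :: hs) ∧ B₁.WF hs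
  | .two _ _ B₁ B₂ => B₁.WF hs ∧ B₂.WF hs
  | .three _ .fwdExc A B₁ B₂ => A.IsSubproc ∧ A.WF (A.name :: hs) ∧ B₁.WF hs ∧ B₂.WF hs
  | .three _ .nonInt A B₁ B₂ => A.IsSubproc ∧ A.WF hs ∧ B₁.WF hs ∧ B₂.WF hs
  | .four _ E₁ E₂ B₁ B₂ =>
      E₁.IsEvent ∧ E₂.IsEvent ∧ E₁.WF hs ∧ E₂.WF hs ∧ B₁.WF hs ∧ B₂.WF hs

end

end DAB

/-- A data-aware BPMN model: a data schema together with a root block over it. -/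
structure DABModel where
  D : DAB.DataSchema
  B : Type
  finB : Finite B
  root : DAB.Block D B
  root_proc : root.IsProc
  root_wf : root.WF []
  names_nodup : root.names.Nodup

namespace DAB

/-! ### Progression rules -/

/-- `lifecycle b = l`, read as a test or as an assignment. -/
abbrev CtrlEq (B : Type) : Type := Ctrl B × Life

/-- A control-flow rule: if the control variables of the case have the values `test` and the
conditions hold, then assign `upd`. -/
structure CRule (D : DataSchema) (B : Type) where
  test : List (CtrlEq B)
  cond : List (Cond D B)
  upd : List (CtrlEq B)

/-- A rule that carries (a disjunct of) the precondition and the effect of an update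
specification. -/
structure URule (D : DataSchema) (B : Type) where
  test : List (CtrlEq B)
  pre : CQ D B
  eff : Effect D B
  upd : List (CtrlEq B)

section
variable {D : DataSchema} {B : Type}

/-- One rule for each disjunct of the precondition. -/
def UpdSpec.rules (u : UpdSpec D B) (test upd : List (CtrlEq B)) : List (URule D B) :=
  u.pre.disjuncts.map fun Q => ⟨test, Q, u.eff, upd⟩

def lc (b : B) (l : Life) : CtrlEq B := (.life b, l)

def Effect.skip : Effect D B := .insertSet none fun _ => none

def LeafKind.crules (b : B) : LeafKind D B → List (CRule D B)
  | .empty => [⟨[lc b .enabled], [], [lc b .completed]⟩]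
  | _ => []

def LeafKind.urules (b : B) : LeafKind D B → List (URule D B)
  | .empty => []
  | .task true u => u.rules [lc b .enabled] [lc b .completed]
  | .task false u =>
      (u.pre.disjuncts.map fun Q => ⟨[lc b .enabled], Q, .skip, [lc b .active]⟩) ++
      [⟨[lc b .active], [], u.eff, [lc b .completed]⟩]
  | .event u => u.rules [lc b .enabled] [lc b .completed]

def UnKind.crules (subs : B → List B) (b b₁ : B) : UnKind D B → List (CRule D B)
  | .proc _ _ => []
  | .subproc =>
      [⟨[lc b .enabled], [], [lc b₁ .enabled, lc b .waiting]⟩,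
       ⟨[lc b₁ .completed], [], [lc b₁ .idle, lc b .completed]⟩]
  | .possErr φ h =>
      [⟨[lc b .enabled], [], [lc b₁ .enabled, lc b .waiting]⟩,
       ⟨[lc b₁ .completed], [φ], [lc b₁ .idle, lc b .completed]⟩,
       ⟨[lc b₁ .completed], [.neg φ],
        lc b₁ .idle :: lc h .error :: (subs h).map fun x => lc x .idle⟩]

def UnKind.urules (b b₁ : B) : UnKind D B → List (URule D B)
  | .proc es et =>
      es.rules [lc b .enabled] [lc b₁ .enabled, lc b .waiting] ++
      et.rules [lc b₁ .completed] [lc b₁ .idle, lc b .completed]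
  | _ => []

/-- Interruption of the block `a` with descendants `hs` by an error. -/
def interrupt (a : B) (hs : List B) : List (CRule D B) :=
  [Life.enabled, .waiting, .active].map fun l =>
    ⟨[lc a l], [], lc a .error :: hs.map fun x => lc x .idle⟩

/-- Rules of a block `b` with nested blocks `b₁`, `b₂`; `hs` are the descendants of `b₁`. -/
def BinKind.crules (b b₁ b₂ : B) (hs : List B) : BinKind D B → List (CRule D B)
  | .seq =>
      [⟨[lc b .enabled], [], [lc b₁ .enabled, lc b .waiting]⟩,
       ⟨[lc b₁ .completed], [], [lc b₁ .idle, lc b₂ .enabled]⟩,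
       ⟨[lc b₂ .completed], [], [lc b₂ .idle, lc b .completed]⟩]
  | .par =>
      [⟨[lc b .enabled], [], [lc b₁ .enabled, lc b₂ .enabled, lc b .waiting]⟩,
       ⟨[lc b₁ .completed, lc b₂ .completed], [], [lc b₁ .idle, lc b₂ .idle, lc b .completed]⟩]
  | .orChoice φ₁ φ₂ =>
      [⟨[lc b .enabled], [φ₁, .neg φ₂], [lc b₁ .enabled, lc b .waiting1]⟩,
       ⟨[lc b .enabled], [φ₂, .neg φ₁], [lc b₂ .enabled, lc b .waiting1]⟩,
       ⟨[lc b .enabled], [φ₁, φ₂], [lc b₁ .enabled, lc b₂ .enabled, lc b .waiting2]⟩,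
       ⟨[lc b₁ .completed, lc b .waiting1], [], [lc b₁ .idle, lc b .completed]⟩,
       ⟨[lc b .waiting1, lc b₂ .completed], [], [lc b₂ .idle, lc b .completed]⟩,
       ⟨[lc b₁ .completed, lc b₂ .completed], [], [lc b₁ .idle, lc b₂ .idle, lc b .completed]⟩]
  | .choice φ =>
      [⟨[lc b .enabled], [φ], [lc b₁ .enabled, lc b .waiting]⟩,
       ⟨[lc b .enabled], [.neg φ], [lc b₂ .enabled, lc b .waiting]⟩,
       ⟨[lc b₁ .completed], [], [lc b₁ .idle, lc b .completed]⟩,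
       ⟨[lc b₂ .completed], [], [lc b₂ .idle, lc b .completed]⟩]
  | .defChoice =>
      [⟨[lc b .enabled], [], [lc b₁ .enabled, lc b .waiting]⟩,
       ⟨[lc b .enabled], [], [lc b₂ .enabled, lc b .waiting]⟩,
       ⟨[lc b₁ .completed], [], [lc b₁ .idle, lc b .completed]⟩,
       ⟨[lc b₂ .completed], [], [lc b₂ .idle, lc b .completed]⟩]
  | .loop φ =>
      [⟨[lc b .enabled], [], [lc b₁ .enabled, lc b .waiting]⟩,
       ⟨[lc b₁ .completed], [φ], [lc b₁ .idle, lc b₂ .enabled]⟩,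
       ⟨[lc b₂ .completed], [], [lc b₁ .enabled, lc b₂ .idle]⟩,
       ⟨[lc b₁ .completed], [.neg φ], [lc b₁ .idle, lc b .completed]⟩]
  | .backExc =>
      [⟨[lc b .enabled], [], [lc b₁ .enabled, lc b .waiting]⟩,
       ⟨[lc b₁ .completed], [], [lc b₁ .idle, lc b .completed]⟩,
       ⟨[lc b₁ .error], [], [lc b₁ .idle, lc b₂ .enabled]⟩,
       ⟨[lc b₂ .completed], [], [lc b₂ .idle, lc b₁ .enabled]⟩] ++ interrupt b₁ hs

def TerKind.crules (b a b₁ b₂ : B) (hs : List B) : TerKind → List (CRule D B)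
  | .fwdExc =>
      [⟨[lc b .enabled], [], [lc a .enabled, lc b .waiting]⟩,
       ⟨[lc a .completed], [], [lc a .idle, lc b₁ .enabled]⟩,
       ⟨[lc b₁ .completed], [], [lc b₁ .idle, lc b .completed]⟩,
       ⟨[lc a .error], [], [lc a .idle, lc b₂ .enabled]⟩,
       ⟨[lc b₂ .completed], [], [lc b₂ .idle, lc b .completed]⟩] ++ interrupt a hs
  | .nonInt =>
      [⟨[lc b .enabled], [], [lc a .enabled, lc b .waiting]⟩,
       ⟨[lc a .completed], [], [lc a .idle, lc b₁ .enabled]⟩,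
       ⟨[lc b₁ .completed, (.err a, .ff)], [], [lc b₁ .idle, lc b .completed]⟩,
       ⟨[(.err a, .tt)], [], [lc b₂ .enabled, (.err a, .tt)]⟩,
       ⟨[lc b₁ .completed, lc b₂ .completed], [], [lc b₁ .idle, lc b₂ .idle, lc b .completed]⟩] ++
      [Life.enabled, .waiting, .active].map fun l => ⟨[lc a l], [], [(.err a, .tt)]⟩

/-- Rules of the event-driven choice `b`. -/
def evRules (b e₁ e₂ b₁ b₂ : B) : List (CRule D B) :=
  [⟨[lc b .enabled], [], [lc e₁ .enabled, lc e₂ .enabled, lc b .waiting]⟩,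
   ⟨[lc e₁ .completed], [], [lc e₁ .idle, lc e₂ .idle, lc b₁ .enabled]⟩,
   ⟨[lc e₂ .completed], [], [lc e₁ .idle, lc e₂ .idle, lc b₂ .enabled]⟩,
   ⟨[lc b₁ .completed], [], [lc b₁ .idle, lc b .completed]⟩,
   ⟨[lc b₂ .completed], [], [lc b₂ .idle, lc b .completed]⟩]

/-- The control-flow rules of a block and its descendants. -/
def Block.crules (subs : B → List B) : Block D B → List (CRule D B)
  | .leaf b k => k.crules b
  | .one b k B₁ => k.crules subs b B₁.name ++ B₁.crules subs
  | .two b k B₁ B₂ =>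
      k.crules b B₁.name B₂.name B₁.subNames ++ B₁.crules subs ++ B₂.crules subs
  | .three b k A B₁ B₂ =>
      k.crules b A.name B₁.name B₂.name A.subNames ++
        A.crules subs ++ B₁.crules subs ++ B₂.crules subs
  | .four b E₁ E₂ B₁ B₂ =>
      evRules b E₁.name E₂.name B₁.name B₂.name ++
        E₁.crules subs ++ E₂.crules subs ++ B₁.crules subs ++ B₂.crules subs

/-- The rules of the update specifications attached to a block and its descendants. -/
def Block.urules : Block D B → List (URule D B)
  | .leaf b k => k.urules b
  | .one b k B₁ => k.urules b B₁.name ++ B₁.urules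
  | .two _ _ B₁ B₂ => B₁.urules ++ B₂.urules
  | .three _ _ A B₁ B₂ => A.urules ++ B₁.urules ++ B₂.urules
  | .four _ E₁ E₂ B₁ B₂ => E₁.urules ++ E₂.urules ++ B₁.urules ++ B₂.urules

end

/-! ### Array-based translation of queries and rules -/

section
variable {D : DataSchema} {B : Type} [Finite B]

/-- A substitution of references for the non-case variables. -/
abbrev Sub (D : DataSchema) (B : Type) [Finite B] : Type :=
  ∀ t : D.Ty, ℕ → Ref (D.setting B) (.data t)

/-- Each case variable `x` becomes the array read `x[i]`, where `i` is a case index variable. -/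
def QTerm.tr (i : ℕ) (σ : Sub D B) : {s : BSort D} → QTerm D B s → ATerm (D.setting B) s
  | _, .var (t := t) n => .var (σ t n)
  | _, .cvar c => .var (.read (A := D.setting B) (E := ASrt.pi) c i)
  | _, .cst c => .cst c

def undefT (s : BSort D) : ATerm (D.setting B) s := .cst (BConst.undef s)

/-- The read `a_{R_k}[e]`. -/
def repRead (R : D.Repo) (k : Fin (D.repoAr R)) (e : ℕ) :
    Ref (D.setting B) (.data (D.repoAttr R k)) :=
  .read (A := D.setting B) (E := ASrt.repo R) (DComp.rep R k) e

/-- `R(t₀, …, t_n)` becomes `t₀ ≠ undef ∧ ⋀ₖ tₖ = fₖ(t₀)`. -/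
def CatAtom.tr (i : ℕ) (σ : Sub D B) (a : CatAtom D B) : QF (D.setting B) :=
  .and (.neg (.eq (a.key.tr i σ) (undefT _)))
    (.conj ((List.finRange (D.catAr a.rel)).map fun k =>
      .eq ((a.arg k).tr i σ) (.app (S := D.sig) (CatFn.mk a.rel k) (a.key.tr i σ))))

/-- `R(t₁, …, t_n)` becomes `⋀ₖ a_{R_k}[e] = tₖ`. -/
def RepoAtom.tr (i : ℕ) (σ : Sub D B) (e : ℕ) (a : RepoAtom D B) : QF (D.setting B) :=
  .conj ((List.finRange (D.repoAr a.rel)).map fun k =>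
    .eq (.var (repRead a.rel k e)) ((a.arg k).tr i σ))

/-- Translation of a literal; `e` is the fresh index variable used if it queries the repository. -/
def Lit.tr (i : ℕ) (σ : Sub D B) (e : ℕ) : Lit D B → QF (D.setting B)
  | .eq t u => .eq (t.tr i σ) (u.tr i σ)
  | .ne t u => .neg (.eq (t.tr i σ) (u.tr i σ))
  | .cat a => a.tr i σ
  | .ncat a => .neg (a.tr i σ)
  | .rep a => a.tr i σ e
  | .nrep a => .neg (a.tr i σ e)

def Cond.tr (i : ℕ) (σ : Sub D B) : Cond D B → QF (D.setting B)
  | .eq t u => .eq (t.tr i σ) (u.tr i σ)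
  | .neg φ => .neg (φ.tr i σ)
  | .and φ ψ => .and (φ.tr i σ) (ψ.tr i σ)

open Classical in
/-- The reference `a_{R_k}[e]` for the first position `k` of the atom at which the variable `(t, n)`
occurs. -/
noncomputable def RepoAtom.defOf (a : RepoAtom D B) (e : ℕ) (t : D.Ty) (n : ℕ) :
    Option (Ref (D.setting B) (.data t)) :=
  (List.finRange (D.repoAr a.rel)).findSome? fun k =>
    match a.arg k with
    | .var m =>
        if h : D.repoAttr a.rel k = t ∧ m = n then some (h.1 ▸ repRead a.rel k e) else none
    | _ => none

/-- The substitution which eliminates the quantifier over a variable `y` with a definition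
`y = a_{R_k}[e]` from a positive repository atom of the query. The repository literal at position `p`
uses the index variable `nm p`; a variable `n` without definition remains, with the name `bn n`. -/
noncomputable def CQ.sub (nm bn : ℕ → ℕ) (Q : CQ D B) : Sub D B := fun t n =>
  (Q.zipIdx.findSome? fun p =>
    match p.1 with
    | .rep a => a.defOf (nm p.2) t n
    | _ => none).getD (.bvar (bn n))

/-- Translation of a conjunctive query with filters at the case index `i`. -/
noncomputable def CQ.tr (i : ℕ) (nm bn : ℕ → ℕ) (Q : CQ D B) : List (QF (D.setting B)) :=
  Q.zipIdx.map fun p => p.1.tr i (Q.sub nm bn) (nm p.2)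

/-- `read` of the array `a` at the bound variable `0` of a transition formula. -/
def readHere {E : ASrt D} {s : BSort D} (a : DComp D B E s) : CTerm (D.setting B) s :=
  .tm (.var (.read (A := D.setting B) a 0))

/-- `if y = e then u else a[y]`, for the variable `e = 1`. -/
def writeAt {E : ASrt D} {s : BSort D} (a : DComp D B E s) (u : ATerm (D.setting B) s) :
    CTerm (D.setting B) s :=
  .ite (.aeq E 0 1) (.tm u) (readHere a)

def ctrlTest (i : ℕ) (p : CtrlEq B) : QF (D.setting B) :=
  .eq (.var (.read (A := D.setting B) (E := ASrt.pi) (DComp.ctl p.1) i)) (.cst (BConst.life p.2))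

open Classical in
/-- The update of a control array: the first matching assignment, at the case index `1`. -/
noncomputable def ctrlUpd (l : List (CtrlEq B)) (c : Ctrl B) : CTerm (D.setting B) .ctrl :=
  match l.find? (fun p => p.1 = c) with
  | some p => writeAt (DComp.ctl c) (.cst (BConst.life p.2))
  | none => readHere (DComp.ctl c)

/-- The transition formula of a control-flow rule; the case index is the variable `1`. -/
noncomputable def CRule.tr (r : CRule D B) : Trans (D.setting B) where
  guard := r.test.map (ctrlTest 1) ++ r.cond.map (Cond.tr 1 fun _ n => .bvar n)
  updX := fun x => x.elim
  updA := fun {_ _} a => match a with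
    | .cv x => readHere (.cv x)
    | .ctl c => ctrlUpd r.upd c
    | .rep R k => readHere (.rep R k)

def SetPart.upd (σ : Sub D B) (set : SetPart D B) (x : D.CVar) :
    CTerm (D.setting B) (.data (D.cvTy x)) :=
  match set x with
  | some u => writeAt (DComp.cv x) (u.tr 1 σ)
  | none => readHere (DComp.cv x)

/-- The additional guard of an effect; `e_ins` and `e_del` are the variable `1` of the sort of the
relation. -/
def Effect.guard (σ : Sub D B) : Effect D B → List (QF (D.setting B))
  | .insertSet (some a) _ => (List.finRange (D.repoAr a.rel)).map fun k =>
      .eq (.var (repRead a.rel k 1)) (undefT _)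
  | .insertSet none _ => []
  | .deleteSet u _ => (List.finRange (D.repoAr u.rel)).map fun k =>
      .eq (.var (repRead u.rel k 1)) ((u.arg k).tr 1 σ)
  | .condUpd _ _ _ => []

def Effect.cvUpd (σ : Sub D B) (x : D.CVar) :
    Effect D B → CTerm (D.setting B) (.data (D.cvTy x))
  | .insertSet _ set => set.upd σ x
  | .deleteSet _ set => set.upd σ x
  | .condUpd _ _ _ => readHere (DComp.cv x)

open Classical in
/-- The variables `v` of a conditional update of `R` are read at the bound index `0`, the other ones
are replaced by `σ`. -/
noncomputable def rowSub (σ : Sub D B) (R : D.Repo) (v : Fin (D.repoAr R) → ℕ) : Sub D B :=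
  fun t n =>
    ((List.finRange (D.repoAr R)).findSome? fun k =>
      if h : D.repoAttr R k = t ∧ v k = n then
        some (h.1 ▸ repRead R k 0 : Ref (D.setting B) (.data t)) else none).getD (σ t n)

/-- Filters are repository-free, so that no index variable is needed for their literals. -/
def CTree.upd (σ : Sub D B) {R : D.Repo} (k : Fin (D.repoAr R)) :
    CTree D B R → CTerm (D.setting B) (.data (D.repoAttr R k))
  | .row u => .tm ((u k).tr 1 σ)
  | .ite ψ t e =>
      .ite (.disj (ψ.map fun Q => .conj (Q.map (Lit.tr 1 σ 0)))) (t.upd σ k) (e.upd σ k)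

open Classical in
/-- The update of the arrays of the repository relation `R`. -/
noncomputable def Effect.repUpd (σ : Sub D B) (R : D.Repo) (k : Fin (D.repoAr R)) :
    Effect D B → CTerm (D.setting B) (.data (D.repoAttr R k))
  | .insertSet (some ⟨R', arg⟩) _ =>
      if h : R' = R then writeAt (DComp.rep R k) (((h ▸ arg :
        ∀ k, QTerm D B (.data (D.repoAttr R k))) k).tr 1 σ)
      else readHere (DComp.rep R k)
  | .insertSet none _ => readHere (DComp.rep R k)
  | .deleteSet u _ =>
      if u.rel = R then writeAt (DComp.rep R k) (undefT _) else readHere (DComp.rep R k)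
  | .condUpd R' v f =>
      if h : R' = R then
        CTree.upd (rowSub σ R (h ▸ v : Fin (D.repoAr R) → ℕ)) k (h ▸ f : CTree D B R)
      else readHere (DComp.rep R k)

/-- The transition formula of a rule with an update (multiset insertion semantics). The case index is
the variable `1`, the repository literal at position `p` of the precondition uses the index variable
`p + 2`. -/
noncomputable def URule.tr (r : URule D B) : Trans (D.setting B) where
  guard := r.test.map (ctrlTest 1) ++ r.pre.tr 1 (· + 2) id ++ r.eff.guard (r.pre.sub (· + 2) id)
  updX := fun x => x.elim
  updA := fun {_ _} a => match a with
    | .cv x => r.eff.cvUpd (r.pre.sub (· + 2) id) x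
    | .ctl c => ctrlUpd r.upd c
    | .rep R k => r.eff.repUpd (r.pre.sub (· + 2) id) R k

end

end DAB

namespace DABModel

open DAB

instance (M : DABModel) : Finite M.B := M.finB

/-- The artifact setting of the translated system. -/
abbrev setting (M : DABModel) : Setting := M.D.setting M.B

/-- The transition formulae translating the control flow. -/
noncomputable def controlTransitions (M : DABModel) : List (Trans M.setting) :=
  (M.root.crules fun h => M.root.subsOf h).map CRule.tr

/-- The transition formulae translating the update specifications. -/
noncomputable def updateTransitions (M : DABModel) : List (Trans M.setting) :=
  M.root.urules.map URule.tr

open Classical in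
/-- Initial value of a control variable: the root block is enabled, every other block is idle, no
error is flagged. -/
noncomputable def iniCtrl (M : DABModel) : Ctrl M.B → Life
  | .life b => if b = M.root.name then .enabled else .idle
  | .err _ => .ff

/-- The relational artifact system translating the model. -/
noncomputable def toRAS (M : DABModel) : RAS where
  A := M.setting
  iniX := fun x => x.elim
  iniA := fun {_ _} a => match a with
    | .cv _ => .undef _
    | .ctl c => .life (M.iniCtrl c)
    | .rep _ _ => .undef _
  trans := M.controlTransitions ++ M.updateTransitions

/-- A property `⋀_{i < n} Gᵢ[i]` over `n` cases: every non-case variable of `Gᵢ` also occurs in an atom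
of `Gᵢ` over the repository. The variables of each guard are local to it. -/
structure Property (M : DABModel) where
  n : ℕ
  G : Fin n → Guard M.D M.B
  safe : ∀ i, ∀ Q ∈ (G i).disjuncts, ∀ x ∈ CQ.vars Q,
    ∃ Q' ∈ (G i).disjuncts, ∃ l ∈ Q', x ∈ Lit.repoVars l

def Property.Separated {M : DABModel} (P : M.Property) : Prop := ∀ i, (P.G i).Separated

/-- The case indexes `0, …, n - 1` are pairwise different. -/
def diffCases (M : DABModel) (n : ℕ) : List (QF M.setting) :=
  (List.range n).flatMap fun j => (List.range j).map fun i => .neg (.aeq ASrt.pi i j)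

/-- The translation of a property into the array-based setting, as the disjunction over all choices
of one disjunct for each guard. The guard `i` is read at the case index variable `i`; its repository
literal at position `p` uses the index variable `⟨i, p⟩`. -/
noncomputable def translate (M : DABModel) (P : M.Property) : EFormula M.setting :=
  (List.ofFn fun i => (P.G i).disjuncts).sections.map fun qs =>
    M.diffCases P.n ++
      qs.zipIdx.flatMap fun p => CQ.tr p.2 (Nat.pair p.2) (Nat.pair p.2) p.1

end DABModel

namespace DAB

/-- Every variable of a disjunct of a separated guard occurs in a repository literal of that
disjunct. -/
theorem Guard.Separated.exists_repoVars {D : DataSchema} {B : Type} {G : Guard D B}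
    (hG : G.Separated)
    (hsafe : ∀ Q ∈ G.disjuncts, ∀ x ∈ CQ.vars Q, ∃ Q' ∈ G.disjuncts, ∃ l ∈ Q', x ∈ Lit.repoVars l)
    {Q : CQ D B} (hQ : Q ∈ G.disjuncts) {x : D.Ty × ℕ} (hx : x ∈ Q.vars) :
    ∃ l ∈ Q, x ∈ Lit.repoVars l := by
  obtain ⟨Q', hQ', l, hl, hxl⟩ := hsafe Q hQ x hx
  by_cases h : Q = Q'
  · exact ⟨l, h ▸ hl, hxl⟩
  · have : Std.Symm fun Q Q' : CQ D B => Disjoint Q.vars Q'.vars := ⟨fun _ _ h => h.symm⟩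
    have hd := hG.1.forall hQ hQ' h
    refine (Set.disjoint_left.1 hd hx ⟨l, hl, ?_⟩).elim
    cases l with
    | rep a => exact hxl
    | nrep a => exact hxl
    | _ => exact hxl.elim

section QueryTranslation

variable {D : DataSchema} {B : Type} [Finite B]

theorem QF.all_conj {A : Setting} {P : ∀ s, Ref A s → Prop} {Q : A.ASort → ℕ → Prop}
    (l : List (QF A)) (h : ∀ c ∈ l, c.All P Q) : (QF.conj l).All P Q := by
  induction l with
  | nil => trivial
  | cons c l ih =>
    exact ⟨h c List.mem_cons_self, ih fun c' hc' => h c' (List.mem_cons_of_mem _ hc')⟩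

theorem QTerm.all_tr {P : ∀ s, Ref (D.setting B) s → Prop} {i : ℕ} {σ : Sub D B} {s : BSort D}
    (u : QTerm D B s) (hσ : ∀ x ∈ u.vars, P _ (σ x.1 x.2))
    (hc : u.CaseFree ∨ ∀ (s : BSort D) (c : DComp D B .pi s),
      P s (.read (A := D.setting B) (E := ASrt.pi) c i)) :
    (u.tr i σ).All P := by
  cases u with
  | var n => exact hσ (_, n) rfl
  | cvar c => exact hc.elim False.elim fun h => h _ c
  | cst c => trivial

theorem CatAtom.all_tr {P : ∀ s, Ref (D.setting B) s → Prop} {Q : ASrt D → ℕ → Prop} {i : ℕ}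
    {σ : Sub D B} (a : CatAtom D B) (hσ : ∀ x ∈ a.vars, P _ (σ x.1 x.2))
    (hc : (a.key.CaseFree ∧ ∀ k, (a.arg k).CaseFree) ∨ ∀ (s : BSort D) (c : DComp D B .pi s),
      P s (.read (A := D.setting B) (E := ASrt.pi) c i)) :
    (a.tr i σ).All P Q := by
  have hkey : (a.key.tr i σ).All P :=
    a.key.all_tr (fun x hx => hσ x (Or.inl hx)) (hc.imp_left And.left)
  refine ⟨⟨hkey, trivial⟩, QF.all_conj _ fun c hc' => ?_⟩
  obtain ⟨k, -, rfl⟩ := List.mem_map.1 hc'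
  exact ⟨(a.arg k).all_tr (fun x hx => hσ x (Or.inr (Set.mem_iUnion.2 ⟨k, hx⟩)))
    (hc.imp_left fun h => h.2 k), hkey⟩

/-- A repository-free literal translates to a formula over the references that replace its
variables. -/
theorem Lit.all_tr {P : ∀ s, Ref (D.setting B) s → Prop} {Q : ASrt D → ℕ → Prop} {i e : ℕ}
    {σ : Sub D B} (l : Lit D B) (hl : l.RepoFree) (hσ : ∀ x ∈ l.vars, P _ (σ x.1 x.2))
    (hc : l.CaseFree ∨ ∀ (s : BSort D) (c : DComp D B .pi s),
      P s (.read (A := D.setting B) (E := ASrt.pi) c i)) :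
    (l.tr i σ e).All P Q := by
  cases l with
  | eq t u =>
    exact ⟨t.all_tr (fun x hx => hσ x (Or.inl hx)) (hc.imp_left And.left),
      u.all_tr (fun x hx => hσ x (Or.inr hx)) (hc.imp_left And.right)⟩
  | ne t u =>
    exact ⟨t.all_tr (fun x hx => hσ x (Or.inl hx)) (hc.imp_left And.left),
      u.all_tr (fun x hx => hσ x (Or.inr hx)) (hc.imp_left And.right)⟩
  | cat a => exact a.all_tr hσ hc
  | ncat a => exact a.all_tr hσ hc
  | rep a => exact hl.elim
  | nrep a => exact hl.elim

theorem RepoAtom.all_tr {P : ∀ s, Ref (D.setting B) s → Prop} {Q : ASrt D → ℕ → Prop} {i e : ℕ}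
    {σ : Sub D B} (a : RepoAtom D B) (ha : a.CaseFree) (hσ : ∀ x ∈ a.vars, P _ (σ x.1 x.2))
    (hr : ∀ k, P _ (repRead a.rel k e)) : (a.tr i σ e).All P Q := by
  refine QF.all_conj _ fun c hc => ?_
  obtain ⟨k, -, rfl⟩ := List.mem_map.1 hc
  exact ⟨hr k, (a.arg k).all_tr (fun x hx => hσ x (Set.mem_iUnion.2 ⟨k, hx⟩)) (Or.inl (ha k))⟩

/-- `r` is a read of an array of `R` at the variable `e`. -/
def IsRepoRead (R : D.Repo) (e : ℕ) (s : BSort D) (r : Ref (D.setting B) s) : Prop :=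
  ∃ a : DComp D B (.repo R) s, r = .read (A := D.setting B) (E := ASrt.repo R) a e

theorem isRepoRead_repRead (R : D.Repo) (k : Fin (D.repoAr R)) (e : ℕ) :
    IsRepoRead (B := B) R e _ (repRead R k e) := ⟨DComp.rep R k, rfl⟩

theorem RepoAtom.isRepoRead_of_defOf {a : RepoAtom D B} {e : ℕ} {t : D.Ty} {n : ℕ}
    {r : Ref (D.setting B) (.data t)} (h : a.defOf e t n = some r) : IsRepoRead a.rel e _ r := by
  obtain ⟨k, -, hk⟩ := List.exists_of_findSome?_eq_some h
  split at hk
  · rename_i m _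
    by_cases h' : D.repoAttr a.rel k = t ∧ m = n
    · rw [dif_pos h'] at hk
      obtain rfl : D.repoAttr a.rel k = t := h'.1
      obtain rfl := Option.some.inj hk
      exact isRepoRead_repRead ..
    · rw [dif_neg h'] at hk
      cases hk
  · cases hk

theorem RepoAtom.defOf_ne_none {a : RepoAtom D B} {e : ℕ} {t : D.Ty} {n : ℕ}
    (h : (t, n) ∈ a.vars) : a.defOf e t n ≠ none := by
  intro hn
  obtain ⟨k, hk⟩ := Set.mem_iUnion.1 h
  have := List.findSome?_eq_none_iff.1 hn k (List.mem_finRange k)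
  revert hk this
  generalize a.arg k = u
  intro hk this
  split at this
  · simp only [QTerm.vars, Set.mem_singleton_iff, Prod.mk.injEq] at hk
    simp [hk.1.symm, hk.2] at this
  · cases u with
    | var m => rename_i h; exact h m rfl
    | cvar c => exact hk
    | cst c => exact hk

/-- If `a` is the only repository atom of the query, all its variables are replaced by reads at one
index variable, which is that of `a`. -/
theorem CQ.exists_sub_eq_read {Q χ ξ : CQ D B} {a : RepoAtom D B} (nm bn : ℕ → ℕ)
    (hQ : Q.Perm (χ ++ [Lit.rep a] ++ ξ)) (hχ : χ.RepoFree) (hξ : ξ.RepoFree) :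
    ∃ p₀, (∀ p, ∀ b, (Lit.rep b, p) ∈ Q.zipIdx → b = a ∧ p = p₀) ∧
      ∀ x ∈ a.vars, IsRepoRead a.rel (nm p₀) _ (Q.sub nm bn x.1 x.2) := by
  have hmem : Lit.rep a ∈ Q := hQ.mem_iff.2 (by simp)
  obtain ⟨Q₁, Q₂, rfl⟩ := List.append_of_mem hmem
  have hperm : (Q₁ ++ Q₂).Perm (χ ++ ξ) := by
    refine List.Perm.cons_inv (a := Lit.rep a) (List.perm_middle.symm.trans (hQ.trans ?_))
    rw [List.append_assoc]
    exact List.perm_middle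
  have hfree : ∀ l ∈ Q₁ ++ Q₂, l.RepoFree := fun l hl =>
    (List.mem_append.1 (hperm.mem_iff.1 hl)).elim (hχ l) (hξ l)
  have huniq : ∀ p, ∀ b, (Lit.rep b, p) ∈ (Q₁ ++ Lit.rep a :: Q₂).zipIdx →
      b = a ∧ p = Q₁.length := by
    intro p b hp
    rw [List.zipIdx_append, List.zipIdx_cons, List.mem_append, List.mem_cons] at hp
    rcases hp with hp | hp | hp
    · exact (hfree _ (List.mem_append_left _ (List.fst_mem_of_mem_zipIdx hp))).elim
    · simpa using hp
    · exact (hfree _ (List.mem_append_right _ (List.fst_mem_of_mem_zipIdx hp))).elim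
  refine ⟨Q₁.length, huniq, fun x hx => ?_⟩
  unfold CQ.sub
  generalize hr : List.findSome? _ _ = r
  cases r with
  | none =>
    refine (RepoAtom.defOf_ne_none (e := nm Q₁.length) hx ?_).elim
    exact List.findSome?_eq_none_iff.1 hr (Lit.rep a, Q₁.length)
      (by rw [List.zipIdx_append, List.zipIdx_cons]; simp)
  | some r =>
    obtain ⟨⟨l, p⟩, hp, hlp⟩ := List.exists_of_findSome?_eq_some hr
    cases l with
    | rep b =>
      obtain ⟨rfl, rfl⟩ := huniq p b hp
      exact RepoAtom.isRepoRead_of_defOf hlp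
    | _ => cases hlp

theorem CQ.onlyEntry_of_mem_tr {Q χ ξ : CQ D B} {r : Option (RepoAtom D B)} {i : ℕ}
    {nm bn : ℕ → ℕ} (hQ : Q.Perm (χ ++ r.toList.map Lit.rep ++ ξ)) (hχ : χ.RepoFree)
    (hr : ∀ a ∈ r, a.CaseFree) (hξ : ξ.RepoFree) (hξc : ∀ l ∈ ξ, l.CaseFree)
    (hχv : ∀ l ∈ χ, ∀ x, x ∉ l.vars) (hξv : ∀ l ∈ ξ, ∀ x ∈ l.vars, ∃ a ∈ r, x ∈ a.vars)
    {c : QF (D.setting B)} (hc : c ∈ Q.tr i nm bn) : ∃ E n, c.OnlyEntry E n := by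
  obtain ⟨⟨l, p⟩, hp, rfl⟩ := List.mem_map.1 hc
  have hl := hQ.mem_iff.1 (List.fst_mem_of_mem_zipIdx hp)
  simp only [List.mem_append, List.mem_map, Option.mem_toList] at hl
  rcases hl with (hl | ⟨a, ha, rfl⟩) | hl
  · exact ⟨ASrt.pi, i, l.all_tr (hχ l hl) (fun x hx => (hχv l hl x hx).elim)
      (Or.inr fun s c => ⟨c, rfl⟩)⟩
  · obtain rfl : r = some a := ha
    obtain ⟨p₀, huniq, hsub⟩ := CQ.exists_sub_eq_read nm bn hQ hχ hξ
    obtain ⟨-, rfl⟩ := huniq p a hp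
    exact ⟨ASrt.repo a.rel, nm p, a.all_tr (hr a rfl) hsub fun k => isRepoRead_repRead ..⟩
  · cases r with
    | none =>
      exact ⟨ASrt.pi, i, l.all_tr (hξ l hl) (fun x hx => by simpa using hξv l hl x hx)
        (Or.inl (hξc l hl))⟩
    | some a =>
      obtain ⟨p₀, huniq, hsub⟩ := CQ.exists_sub_eq_read nm bn hQ hχ hξ
      refine ⟨ASrt.repo a.rel, nm p₀, l.all_tr (hξ l hl) (fun x hx => hsub x ?_)
        (Or.inl (hξc l hl))⟩
      obtain ⟨b, hb, hx⟩ := hξv l hl x hx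
      exact Option.some.inj hb ▸ hx

theorem Guard.Separated.onlyEntry_of_mem_tr {G : Guard D B} (hG : G.Separated)
    (hsafe : ∀ Q ∈ G.disjuncts, ∀ x ∈ CQ.vars Q, ∃ Q' ∈ G.disjuncts, ∃ l ∈ Q', x ∈ Lit.repoVars l)
    {Q : CQ D B} (hQ : Q ∈ G.disjuncts) {i : ℕ} {nm bn : ℕ → ℕ} {c : QF (D.setting B)}
    (hc : c ∈ Q.tr i nm bn) : ∃ E n, c.OnlyEntry E n := by
  obtain ⟨χ, r, ξ, hperm, hχ, hr, hξ, hξc, hχξ⟩ := hG.2 Q hQ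
  have key : ∀ x ∈ Q.vars, ∃ a ∈ r, x ∈ a.vars := by
    intro x hx
    obtain ⟨l, hl, hxl⟩ := hG.exists_repoVars hsafe hQ hx
    have hl' := hperm.mem_iff.1 hl
    simp only [List.mem_append, List.mem_map, Option.mem_toList] at hl'
    have hfree : ¬ l.RepoFree := by
      cases l with
      | rep a => exact id
      | nrep a => exact id
      | _ => exact hxl.elim
    rcases hl' with (h | ⟨a, ha, rfl⟩) | h
    · exact (hfree (hχ l h)).elim
    · exact ⟨a, ha, hxl⟩
    · exact (hfree (hξ l h)).elim
  refine CQ.onlyEntry_of_mem_tr hperm hχ (fun a ha => (hr a ha).1) hξ hξc ?_ ?_ hc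
  · intro l hl x hx
    obtain ⟨a, ha, hxa⟩ := key x ⟨l, hperm.mem_iff.2 (by simp [hl]), hx⟩
    exact Set.disjoint_left.1 (hr a ha).2 ⟨l, hl, hx⟩ hxa
  · exact fun l hl x hx => key x ⟨l, hperm.mem_iff.2 (by simp [hl]), hx⟩

end QueryTranslation

section StrongLocality

variable {A : Setting}

theorem Term.All.mono {S : DBSig} {V : S.Srt → Type} {P Q : ∀ s, V s → Prop}
    (h : ∀ s x, P s x → Q s x) {s : S.Srt} {t : Term S V s} (ht : t.All P) : t.All Q := by
  induction t with
  | var v => exact h _ _ ht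
  | cst c => trivial
  | app f u ih => exact ih ht

theorem QF.All.mono {P P' : ∀ s, Ref A s → Prop} {Q Q' : A.ASort → ℕ → Prop}
    (h : ∀ s r, P s r → P' s r) (h' : ∀ E n, Q E n → Q' E n) {c : QF A} (hc : c.All P Q) :
    c.All P' Q' := by
  induction c with
  | tru => trivial
  | eq t u => exact ⟨hc.1.mono h, hc.2.mono h⟩
  | aeq E n m => exact ⟨h' _ _ hc.1, h' _ _ hc.2⟩
  | neg φ ih => exact ih hc
  | and φ ψ ih₁ ih₂ => exact ⟨ih₁ hc.1, ih₂ hc.2⟩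

/-- The conjuncts allowed in strongly local formulae. -/
def QF.IsLocal (c : QF A) : Prop := c.IsDelta ∨ c.OnlyAVars ∨ ∃ E n, c.OnlyEntry E n

theorem QF.IsLocal.noBasicVar {c : QF A} (hc : c.IsLocal) : c.NoBasicVar := by
  rcases hc with ⟨E, n, m, rfl | rfl⟩ | hc | ⟨E, n, hc⟩
  · exact ⟨trivial, trivial⟩
  · exact ⟨trivial, trivial⟩
  · refine QF.All.mono ?_ (fun _ _ _ => trivial) hc
    rintro s _ ⟨x, rfl⟩ n
    simp
  · refine QF.All.mono ?_ (fun _ _ _ => trivial) hc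
    rintro s _ ⟨x, rfl⟩ n
    simp

theorem stronglyLocal_iff {φ : EFormula A} :
    StronglyLocal φ ↔ ∀ d ∈ φ, ∀ c ∈ d, c.IsLocal :=
  ⟨fun h => h.2, fun h => ⟨fun d hd c hc => (h d hd c hc).noBasicVar, h⟩⟩

end StrongLocality

end DAB

namespace DABModel

open DAB

theorem stronglyLocal_translate (M : DABModel) (P : M.Property) (hP : P.Separated) :
    StronglyLocal (M.translate P) := by
  refine stronglyLocal_iff.2 fun d hd c hc => ?_
  obtain ⟨qs, hqs, rfl⟩ := List.mem_map.1 hd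
  rcases List.mem_append.1 hc with hc | hc
  · obtain ⟨j, -, hc⟩ := List.mem_flatMap.1 hc
    obtain ⟨i, -, rfl⟩ := List.mem_map.1 hc
    exact Or.inl ⟨_, _, _, Or.inr rfl⟩
  · obtain ⟨⟨Q, i⟩, hp, hc⟩ := List.mem_flatMap.1 hc
    have hQ : ∃ j, Q ∈ (P.G j).disjuncts := by
      have hall := List.mem_sections.1 hqs
      obtain ⟨k, hk, rfl⟩ := List.mem_iff_getElem.1 (List.fst_mem_of_mem_zipIdx hp)
      have hk' := hall.length_eq ▸ hk
      have := List.Forall₂.get hall hk hk'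
      simp only [List.get_eq_getElem, List.getElem_ofFn] at this
      exact ⟨_, this⟩
    obtain ⟨j, hQ⟩ := hQ
    exact Or.inr (Or.inr ((hP j).onlyEntry_of_mem_tr (P.safe j) hQ hc))

end DABModel

namespace DAB

section Terms

variable {S : DBSig} {V W : S.Srt → Type}

/-- Substitution of terms for variables. -/
def Term.subst (f : ∀ s, V s → Term S W s) : {s : S.Srt} → Term S V s → Term S W s
  | _, .var x => f _ x
  | _, .cst c => .cst c
  | _, .app g u => .app g (u.subst f)

theorem Term.eval_subst (M : DBStr S) (v : ∀ s, W s → M.car s) (f : ∀ s, V s → Term S W s)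
    {s : S.Srt} (t : Term S V s) :
    (t.subst f).eval M v = t.eval M fun s x => (f s x).eval M v := by
  induction t with
  | var x => rfl
  | cst c => rfl
  | app g u ih => simp only [Term.subst, Term.eval, ih]

theorem Term.all_subst {P : ∀ s, V s → Prop} {Q : ∀ s, W s → Prop} {f : ∀ s, V s → Term S W s}
    (h : ∀ s x, P s x → (f s x).All Q) {s : S.Srt} {t : Term S V s} (ht : t.All P) :
    (t.subst f).All Q := by
  induction t with
  | var x => exact h _ _ ht
  | cst c => trivial
  | app g u ih => exact ih ht

theorem Term.eval_congr {P : ∀ s, V s → Prop} (M : DBStr S) {v w : ∀ s, V s → M.car s}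
    (h : ∀ s x, P s x → v s x = w s x) {s : S.Srt} {t : Term S V s} (ht : t.All P) :
    t.eval M v = t.eval M w := by
  induction t with
  | var x => exact h _ _ ht
  | cst c => rfl
  | app g u ih => exact congrArg (M.fn g) (ih ht)

theorem Term.exists_eq_subst {g : ∀ s, V s → W s} {s : S.Srt} {t : Term S W s}
    (ht : t.All fun s r => ∃ a, r = g s a) :
    ∃ t' : Term S V s, t = t'.subst fun s a => .var (g s a) := by
  induction t with
  | var x =>
    obtain ⟨a, rfl⟩ := ht
    exact ⟨.var a, rfl⟩
  | cst c => exact ⟨.cst c, rfl⟩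
  | app f u ih =>
    obtain ⟨u', rfl⟩ := ih ht
    exact ⟨.app f u', rfl⟩

/-- The equalities between terms over `V` that hold in `M` under `v`. -/
def diagram (M : DBStr S) (v : ∀ s, V s → M.car s) : Set (Σ s, Term S V s × Term S V s) :=
  {p | p.2.1.eval M v = p.2.2.eval M v}

/-- Over an acyclic signature there are finitely many terms in finitely many variables. -/
theorem DBSig.Acyclic.finite_term (hS : S.Acyclic) (hV : Finite (Σ s, V s)) :
    Finite (Σ s, Term S V s) := by
  have := S.finSrt
  have := S.finFn
  have := S.finCn
  have hV' : ∀ s, Finite (V s) := fun s =>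
    Finite.of_injective (fun x => (⟨s, x⟩ : Σ s, V s)) sigma_mk_injective
  have hC : ∀ s, Finite (S.Cn s) := fun s =>
    Finite.of_injective (fun x => (⟨s, x⟩ : Σ s, S.Cn s)) sigma_mk_injective
  have hF : ∀ s t, Finite (S.Fn s t) := fun s t =>
    Finite.of_injective (fun x => (⟨s, t, x⟩ : Σ s t, S.Fn s t)) fun _ _ h => by simpa using h
  have : Std.Irrefl (Relation.TransGen S.Edge) := ⟨hS⟩
  have wf : WellFounded (Relation.TransGen S.Edge) := Finite.wellFounded_of_trans_of_irrefl _
  have key : ∀ t, Finite (Term S V t) := by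
    intro t
    induction t using wf.induction with
    | _ t ih =>
      have : ∀ s, Finite (S.Fn s t × Term S V s) := by
        intro s
        by_cases h : Nonempty (S.Fn s t)
        · have := ih s (.single h)
          infer_instance
        · have := not_nonempty_iff.1 h
          infer_instance
      let f : V t ⊕ S.Cn t ⊕ (Σ s, S.Fn s t × Term S V s) → Term S V t := fun
        | .inl x => .var x
        | .inr (.inl c) => .cst c
        | .inr (.inr p) => .app p.2.1 p.2.2
      refine Finite.of_surjective f ?_
      rintro (x | c | ⟨g, u⟩)
      exacts [⟨.inl x, rfl⟩, ⟨.inr (.inl c), rfl⟩, ⟨.inr (.inr ⟨_, g, u⟩), rfl⟩]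
  infer_instance

theorem DBSig.Acyclic.finite_term_pair (hS : S.Acyclic) (hV : Finite (Σ s, V s)) :
    Finite (Σ s, Term S V s × Term S V s) := by
  have := hS.finite_term hV
  refine Finite.of_injective (β := (Σ s, Term S V s) × Σ s, Term S V s)
    (fun p => (⟨p.1, p.2.1⟩, ⟨p.1, p.2.2⟩)) ?_
  rintro ⟨s, t, u⟩ ⟨s', t', u'⟩ h
  simp only [Prod.mk.injEq, Sigma.mk.injEq] at h
  obtain ⟨⟨rfl, h₁⟩, -, h₂⟩ := h
  rw [eq_of_heq h₁, eq_of_heq h₂]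

end Terms

section Configurations

variable {A : Setting}

theorem QF.holds_iff_of_diagram_eq {V : A.sig.Srt → Type} {g : ∀ s, V s → Ref A s}
    {Q : A.ASort → ℕ → Prop} (hQ : ∀ E n m, Q E n → Q E m → n = m) {M M' : Str A} {α : Asg M}
    {α' : Asg M'} {ρ : AEnv M} {ρ' : AEnv M'} {v : BEnv M} {v' : BEnv M'}
    (h : diagram M.base (fun s a => Ref.eval α ρ v s (g s a)) =
      diagram M'.base (fun s a => Ref.eval α' ρ' v' s (g s a)))
    {c : QF A} (hc : c.All (fun s r => ∃ a, r = g s a) Q) :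
    c.Holds α ρ v ↔ c.Holds α' ρ' v' := by
  induction c with
  | tru => exact Iff.rfl
  | eq t u =>
    obtain ⟨t, rfl⟩ := Term.exists_eq_subst hc.1
    obtain ⟨u, rfl⟩ := Term.exists_eq_subst hc.2
    have := Set.ext_iff.1 h ⟨_, t, u⟩
    simpa only [diagram, Set.mem_ofPred_eq, QF.Holds, Term.eval_subst, Term.eval] using this
  | aeq E n m =>
    obtain rfl := hQ E n m hc.1 hc.2
    exact iff_of_true rfl rfl
  | neg φ ih => exact not_congr (ih hc)
  | and φ ψ ih₁ ih₂ => exact and_congr (ih₁ hc.1) (ih₂ hc.2)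

/-- The equalities between terms over the arrays of sort `E`, read at `e`, that hold. -/
def entryType {M : Str A} (α : Asg M) {E : A.ASort} (e : M.art E) :
    Set (Σ s, Term A.sig (A.Comp E) s × Term A.sig (A.Comp E) s) :=
  diagram M.base fun _ a => α.a a e

theorem QF.OnlyEntry.holds_iff {E : A.ASort} {n : ℕ} {c : QF A} (hc : c.OnlyEntry E n)
    {M M' : Str A} {α : Asg M} {α' : Asg M'} {ρ : AEnv M} {ρ' : AEnv M'} {v : BEnv M} {v' : BEnv M'}
    (h : entryType α (ρ E n) = entryType α' (ρ' E n)) : c.Holds α ρ v ↔ c.Holds α' ρ' v' := by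
  refine QF.holds_iff_of_diagram_eq (V := A.Comp E) (g := fun s a => Ref.read a n) ?_ ?_ hc
  · rintro _ _ _ ⟨-, rfl⟩ ⟨-, rfl⟩
    rfl
  · exact h

/-- The equalities between terms over the artifact variables that hold. -/
def varType {M : Str A} (α : Asg M) : Set (Σ s, Term A.sig A.AVar s × Term A.sig A.AVar s) :=
  diagram M.base fun _ x => α.x x

/-- The number of entries of a given type. -/
noncomputable def entryCount {M : Str A} (α : Asg M)
    (p : Σ E, Set (Σ s, Term A.sig (A.Comp E) s × Term A.sig (A.Comp E) s)) : Cardinal.{0} :=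
  Cardinal.mk {e : M.art p.1 // entryType α e = p.2}

theorem exists_embedding_of_entryCount_le {M M' : Str A} {α : Asg M} {α' : Asg M'}
    (h : entryCount α ≤ entryCount α') (E : A.ASort) :
    ∃ f : M.art E → M'.art E, Function.Injective f ∧
      ∀ e, entryType α' (f e) = entryType α e := by
  have hle : ∀ t, Nonempty ({e : M.art E // entryType α e = t} ↪
      {e : M'.art E // entryType α' e = t}) := fun t => h ⟨E, t⟩
  let f := fun t => (hle t).some
  have hf : ∀ e, entryType α' (f (entryType α e) ⟨e, rfl⟩).1 = entryType α e :=
    fun e => (f (entryType α e) ⟨e, rfl⟩).2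
  refine ⟨fun e => (f (entryType α e) ⟨e, rfl⟩).1, fun e₁ e₂ he => ?_, hf⟩
  have ht : entryType α e₁ = entryType α e₂ := by
    rw [← hf e₁, ← hf e₂]
    exact congrArg _ he
  have aux : ∀ t₁ t₂ (h₁ : entryType α e₁ = t₁) (h₂ : entryType α e₂ = t₂), t₁ = t₂ →
      (f t₁ ⟨e₁, h₁⟩).1 = (f t₂ ⟨e₂, h₂⟩).1 → e₁ = e₂ := by
    rintro t _ h₁ h₂ rfl h
    exact congrArg Subtype.val ((f t).injective (Subtype.ext h))
  exact aux _ _ rfl rfl ht he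

theorem StronglyLocal.holds_of_le {φ : EFormula A} (hφ : StronglyLocal φ) {M M' : Str A}
    {α : Asg M} {α' : Asg M'} (hx : varType α = varType α') (ha : entryCount α ≤ entryCount α')
    (h : φ.Holds α) : φ.Holds α' := by
  obtain ⟨d, hd, ρ, v, h⟩ := h
  choose f hf ht using exists_embedding_of_entryCount_le ha
  refine ⟨d, hd, fun E n => f E (ρ E n), fun s _ => M'.base.cn (A.sig.undef s), fun c hc => ?_⟩
  have hval := h c hc
  rcases hφ.2 d hd c hc with ⟨E, n, m, rfl | rfl⟩ | hloc | ⟨E, n, hloc⟩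
  · exact congrArg (f E) hval
  · exact fun he => hval (hf E he)
  · exact (QF.holds_iff_of_diagram_eq (g := fun s x => Ref.avar x) (fun _ _ _ h => h.elim) hx
      hloc).1 hval
  · exact (hloc.holds_iff (ht E (ρ E n)).symm).1 hval

/-- Over an acyclic signature, the assignments are well-quasi-ordered by the number of entries of
each type. -/
theorem exists_lt_entryCount_le (hS : A.sig.Acyclic) (M : ℕ → Str A) (α : ∀ n, Asg (M n)) :
    ∃ i j, i < j ∧ varType (α i) = varType (α j) ∧ entryCount (α i) ≤ entryCount (α j) := by
  have := A.finASort
  have hfin := A.finComp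
  have := hS.finite_term_pair A.finAVar
  have : ∀ E, Finite (Σ s, Term A.sig (A.Comp E) s × Term A.sig (A.Comp E) s) := fun E =>
    hS.finite_term_pair (Finite.of_injective
      (fun p => (⟨E, p⟩ : Σ E s, A.Comp E s))
      (sigma_mk_injective (β := fun E => Σ s, A.Comp E s)))
  have h₁ : WellQuasiOrdered
      (Eq : Set (Σ s, Term A.sig A.AVar s × Term A.sig A.AVar s) → _ → Prop) :=
    Finite.wellQuasiOrdered _
  have h₂ : WellQuasiOrdered ((· ≤ ·) :
      ((Σ E, Set (Σ s, Term A.sig (A.Comp E) s × Term A.sig (A.Comp E) s)) →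
        Cardinal.{0}) → _ → Prop) := wellQuasiOrdered_le
  exact h₁.prod h₂ fun n => (varType (α n), entryCount (α n))

end Configurations

section Termination

variable {A : Setting}

theorem Term.eval_embedding {S : DBSig} {V : S.Srt → Type} {M N : DBStr S} (i : M.Embedding N)
    {P : ∀ s, V s → Prop} {v : ∀ s, V s → M.car s} {w : ∀ s, V s → N.car s}
    (h : ∀ s x, P s x → w s x = i.map s (v s x)) {s : S.Srt} {t : Term S V s} (ht : t.All P) :
    t.eval N w = i.map s (t.eval M v) := by
  induction t with
  | var x => exact h _ _ ht
  | cst c => exact (i.map_cn c).symm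
  | app f u ih => exact (congrArg (N.fn f) (ih ht)).trans (i.map_fn f _).symm

/-- Replacement of the database by an extension. -/
def Str.extend (M : Str A) (N : DBStr A.sig) : Str A := ⟨N, M.art, M.art_nonempty⟩

def Asg.extend {M : Str A} (α : Asg M) {N : DBStr A.sig} (i : M.base.Embedding N) :
    Asg (M.extend N) where
  x := fun x => i.map _ (α.x x)
  a := fun a e => i.map _ (α.a a e)

theorem QF.holds_extend {M : Str A} {α : Asg M} {N : DBStr A.sig} (i : M.base.Embedding N)
    {ρ : AEnv M} {v : BEnv M} {w : BEnv (M.extend N)} {c : QF A} (hc : c.NoBasicVar) :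
    c.Holds (α.extend i) (M := M.extend N) ρ w ↔ c.Holds α ρ v := by
  have key : ∀ {s} {t : ATerm A s}, t.All (fun s r => ∀ n, r ≠ (.bvar n : Ref A s)) →
      t.eval N (Ref.eval (M := M.extend N) (α.extend i) ρ w) =
        i.map s (t.eval M.base (Ref.eval α ρ v)) := by
    refine fun {s t} ht => Term.eval_embedding i (fun s r hr => ?_) ht
    cases r with
    | avar x => rfl
    | bvar n => exact (hr n rfl).elim
    | read a n => rfl
  induction c with
  | tru => exact Iff.rfl
  | eq t u =>
    refine Iff.trans (Eq.congr (key hc.1) (key hc.2)) (i.inj _).eq_iff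
  | aeq E n m => exact Iff.rfl
  | neg φ ih => exact not_congr (ih hc)
  | and φ ψ ih₁ ih₂ => exact and_congr (ih₁ hc.1) (ih₂ hc.2)

theorem IsState.holds_extend {φ : EFormula A} (hφ : IsState φ) {M : Str A} {α : Asg M}
    {N : DBStr A.sig} (i : M.base.Embedding N) : φ.Holds (α.extend i) ↔ φ.Holds α := by
  constructor
  · rintro ⟨d, hd, ρ, w, h⟩
    exact ⟨d, hd, ρ, fun s _ => M.base.cn (A.sig.undef s), fun c hc =>
      (QF.holds_extend i (hφ d hd c hc)).1 (h c hc)⟩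
  · rintro ⟨d, hd, ρ, v, h⟩
    exact ⟨d, hd, ρ, fun s _ => N.cn (A.sig.undef s), fun c hc =>
      (QF.holds_extend i (hφ d hd c hc)).2 (h c hc)⟩

theorem EFormula.holds_append {φ ψ : EFormula A} {M : Str A} {α : Asg M} :
    (φ ++ ψ : EFormula A).Holds α ↔ φ.Holds α ∨ ψ.Holds α := by
  simp only [EFormula.Holds, List.mem_append, or_and_right, exists_or]

theorem pre_cons {τ : Trans A} {ts : List (Trans A)} {φ : EFormula A} {M : Str A} {α : Asg M} :
    Pre (τ :: ts) φ α ↔ Pre [τ] φ α ∨ Pre ts φ α := by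
  simp only [Pre, List.mem_cons, List.not_mem_nil, or_false, or_and_right, exists_or,
    exists_eq_left]

theorem exists_stronglyLocal_isPreMod {Tstar : Set (FO A.sig)} {ts : List (Trans A)}
    (hts : ∀ τ ∈ ts, StronglyLocalTrans Tstar τ) {ψ : EFormula A} (hψ : StronglyLocal ψ) :
    ∃ φ, StronglyLocal φ ∧ IsPreMod Tstar ts ψ φ := by
  induction ts with
  | nil =>
    refine ⟨[], ⟨by simp [IsState], by simp⟩, fun M _ α => ?_⟩
    simp [EFormula.Holds, Pre]
  | cons τ ts ih =>
    obtain ⟨φ₁, h₁, h₁'⟩ := hts τ List.mem_cons_self ψ hψ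
    obtain ⟨φ₂, h₂, h₂'⟩ := ih fun τ' h => hts τ' (List.mem_cons_of_mem _ h)
    refine ⟨φ₁ ++ φ₂, stronglyLocal_iff.2 fun d hd => ?_, fun M hM α => ?_⟩
    · exact (List.mem_append.1 hd).elim (h₁.2 d) (h₂.2 d)
    · rw [EFormula.holds_append, pre_cons, h₁' M hM, h₂' M hM]

/-- Backward reachability terminates on strongly local formulae if the signature is acyclic and
the transitions are strongly local. -/
theorem backReachTerminates_of_stronglyLocal (S : RAS) {Tstar : Set (FO S.A.sig)}
    (hT : IsModelCompletion S.A.sig Tstar) (hS : S.A.sig.Acyclic)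
    (hts : ∀ τ ∈ S.trans, StronglyLocalTrans Tstar τ) {υ : EFormula S.A}
    (hυ : StronglyLocal υ) : BackReachTerminates S Tstar υ := by
  intro preQE hQE
  by_contra hhalt
  let φ : ℕ → EFormula S.A := fun n => preQE^[n] υ
  have hφ : ∀ n, φ (n + 1) = preQE (φ n) := fun n => Function.iterate_succ_apply' ..
  have hstate : ∀ n, IsState (φ n) := by
    intro n
    induction n with
    | zero => exact hυ.1
    | succ n ih => exact hφ n ▸ (hQE _ ih).1
  have hlocal : ∀ n, ∃ σ, StronglyLocal σ ∧
      ∀ M : Str S.A, M.base.Models Tstar → ∀ α : Asg M, (φ n).Holds α ↔ σ.Holds α := by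
    intro n
    induction n with
    | zero => exact ⟨υ, hυ, fun _ _ _ => Iff.rfl⟩
    | succ n ih =>
      obtain ⟨σ, hσ, hσ'⟩ := ih
      obtain ⟨σ', h, h'⟩ := exists_stronglyLocal_isPreMod hts hσ
      refine ⟨σ', h, fun M hM α => ?_⟩
      rw [h' M hM α, hφ, (hQE _ (hstate n)).2 M hM α]
      exact exists_congr fun α' => and_congr_right' (hσ' M hM α')
  have hloop : ∀ n, ∃ B : EFormula S.A, ¬ LoopHalts S preQE (φ n) B ∧
      IsState B ∧ ∀ i < n, ∀ {M : Str S.A} {α : Asg M}, (φ i).Holds α → B.Holds α := by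
    intro n
    induction n with
    | zero => exact ⟨[], hhalt, by simp [IsState], by simp⟩
    | succ n ih =>
      obtain ⟨B, hB, hBs, hi⟩ := ih
      refine ⟨φ n ++ B, fun hl => hB ?_, ?_, fun i hin M α h => ?_⟩
      · by_cases h : TSat fun {_} α => (φ n).Holds α ∧ ¬ B.Holds α
        · by_cases h' : TSat fun {_} α => S.Initial α ∧ (φ n).Holds α
          · exact .unsafety h h'
          · exact .loop h h' (hφ n ▸ hl)
        · exact .safe h
      · exact fun d hd => (List.mem_append.1 hd).elim (hstate n d) (hBs d)
      · rw [EFormula.holds_append]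
        rcases Nat.lt_succ_iff_lt_or_eq.1 hin with hin | rfl
        · exact Or.inr (hi i hin h)
        · exact Or.inl h
  have hwit : ∀ n, ∃ (M : Str S.A) (α : Asg M), M.base.Models Tstar ∧ (φ n).Holds α ∧
      ∀ i < n, ¬ (φ i).Holds α := by
    intro n
    obtain ⟨B, hB, hBs, hi⟩ := hloop n
    have hsat : TSat fun {_} α => (φ n).Holds α ∧ ¬ B.Holds α := by
      by_contra h
      exact hB (.safe h)
    obtain ⟨M, hM, α, h₁, h₂⟩ := hsat
    obtain ⟨N, hN, ⟨i⟩⟩ := hT.embeds M.base hM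
    refine ⟨M.extend N, α.extend i, hN, ((hstate n).holds_extend i).2 h₁, fun k hk h => ?_⟩
    exact h₂ ((hBs.holds_extend i).1 (hi k hk h))
  choose M α hM hpos hneg using hwit
  obtain ⟨i, j, hij, hx, ha⟩ := exists_lt_entryCount_le hS M α
  obtain ⟨σ, hσ, hσ'⟩ := hlocal i
  exact hneg j i hij ((hσ' _ (hM j) _).2
    (hσ.holds_of_le hx ha ((hσ' _ (hM i) _).1 (hpos i))))

end Termination

end DAB

namespace DAB

section QuantifierElimination

/-- Existential closure over the variables in a list. -/
def FO.exs {S : DBSig} : List (S.Srt × ℕ) → FO S → FO S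
  | [], φ => φ
  | p :: l, φ => .neg (.all p.1 p.2 (.neg (FO.exs l φ)))

theorem FO.holds_exs {S : DBSig} {M : DBStr S} (l : List (S.Srt × ℕ)) (φ : FO S)
    (v : ∀ s, ℕ → M.car s) : (FO.exs l φ).Holds M v ↔
      ∃ w : ∀ s, ℕ → M.car s, (∀ s n, (s, n) ∉ l → w s n = v s n) ∧ φ.Holds M w := by
  classical
  induction l generalizing v with
  | nil =>
    refine ⟨fun h => ⟨v, fun _ _ _ => rfl, h⟩, ?_⟩
    rintro ⟨w, hw, h⟩
    obtain rfl : w = v := funext fun s => funext fun n => hw s n List.not_mem_nil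
    exact h
  | cons p l ih =>
    obtain ⟨t, m⟩ := p
    simp only [FO.exs, FO.Holds, not_forall, not_not, ih]
    constructor
    · rintro ⟨x, w, hw, h⟩
      refine ⟨w, fun s n hn => ?_, h⟩
      rw [List.mem_cons, not_or] at hn
      rw [hw s n hn.2]
      by_cases hs : s = t
      · subst hs
        have : n ≠ m := fun h => hn.1 (by rw [h])
        simp [this]
      · simp [hs]
    · rintro ⟨w, hw, h⟩
      refine ⟨w t m, w, fun s n hn => ?_, h⟩
      by_cases hs : s = t
      · subst hs
        by_cases hnm : n = m
        · subst hnm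
          simp
        · simp only [Function.update_self, Function.update_of_ne hnm]
          exact hw s n (by simp [hn, hnm])
      · simp only [Function.update_of_ne hs]
        exact hw s n (by simp [hn, hs])

variable {A : Setting}

/-- The first-order variable that stands for a reference: even names for array reads, odd names for
individual variables. -/
def Ref.name (enc : (Σ E s, A.Comp E s) → ℕ) : ∀ s, Ref A s → ℕ
  | _, .avar _ => 0
  | _, .bvar n => 2 * n + 1
  | _, .read (E := E) (s := s) a _ => 2 * enc ⟨E, s, a⟩

/-- A quantifier-free formula about a single entry as a first-order formula over the database. -/
def QF.toFO (enc : (Σ E s, A.Comp E s) → ℕ) (s₀ : A.sig.Srt) : QF A → FO A.sig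
  | .tru => .eq (.cst (A.sig.undef s₀)) (.cst (A.sig.undef s₀))
  | .eq t u => .eq (t.subst fun s r => .var (r.name enc s)) (u.subst fun s r => .var (r.name enc s))
  | .aeq _ _ _ => .eq (.cst (A.sig.undef s₀)) (.cst (A.sig.undef s₀))
  | .neg φ => .neg (φ.toFO enc s₀)
  | .and φ ψ => .and (φ.toFO enc s₀) (ψ.toFO enc s₀)

theorem QF.holds_toFO {enc : (Σ E s, A.Comp E s) → ℕ} {s₀ : A.sig.Srt} {P : ∀ s, Ref A s → Prop}
    {Q : A.ASort → ℕ → Prop} (hQ : ∀ E n m, Q E n → Q E m → n = m) {M : Str A} {α : Asg M}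
    {ρ : AEnv M} {v : BEnv M} {w : ∀ s, ℕ → M.base.car s}
    (h : ∀ s r, P s r → w s (r.name enc s) = Ref.eval α ρ v s r) {c : QF A} (hc : c.All P Q) :
    (c.toFO enc s₀).Holds M.base w ↔ c.Holds α ρ v := by
  induction c with
  | tru => exact iff_of_true rfl trivial
  | eq t u =>
    simp only [QF.toFO, FO.Holds, QF.Holds, Term.eval_subst, Term.eval]
    rw [Term.eval_congr M.base h hc.1, Term.eval_congr M.base h hc.2]
  | aeq E n m =>
    obtain rfl := hQ E n m hc.1 hc.2
    exact iff_of_true rfl rfl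
  | neg φ ih => exact not_congr (ih hc)
  | and φ ψ ih₁ ih₂ => exact and_congr (ih₁ hc.1) (ih₂ hc.2)

/-- A quantifier-free first-order formula with terms of the setting substituted for its
variables. -/
def FO.toQF (f : ∀ s, ℕ → ATerm A s) : FO A.sig → QF A
  | .eq t u => .eq (t.subst f) (u.subst f)
  | .neg φ => .neg (φ.toQF f)
  | .and φ ψ => .and (φ.toQF f) (ψ.toQF f)
  | .all _ _ _ => .tru

theorem FO.holds_toQF {f : ∀ s, ℕ → ATerm A s} {M : Str A} {α : Asg M} {ρ : AEnv M} {v : BEnv M}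
    {ψ : FO A.sig} (hψ : ψ.QuantifierFree) : (ψ.toQF f).Holds α ρ v ↔
      ψ.Holds M.base fun s k => (f s k).eval M.base (Ref.eval α ρ v) := by
  induction ψ with
  | eq t u => simp only [FO.toQF, QF.Holds, FO.Holds, Term.eval_subst]
  | neg φ ih => exact not_congr (ih hψ)
  | and φ ψ ih₁ ih₂ => exact and_congr (ih₁ hψ.1) (ih₂ hψ.2)
  | all s n φ => exact hψ.elim

theorem FO.all_toQF {f : ∀ s, ℕ → ATerm A s} {P : ∀ s, Ref A s → Prop} {Q : A.ASort → ℕ → Prop}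
    (h : ∀ s k, (f s k).All P) (ψ : FO A.sig) : (ψ.toQF f).All P Q := by
  have hall : ∀ {s} (t : Term A.sig (fun _ => ℕ) s), t.All fun _ _ => True := by
    intro s t
    induction t with
    | var => trivial
    | cst => trivial
    | app _ _ ih => exact ih
  induction ψ with
  | eq t u => exact ⟨Term.all_subst (fun s k _ => h s k) (hall t),
      Term.all_subst (fun s k _ => h s k) (hall u)⟩
  | neg φ ih => exact ih
  | and φ ψ ih₁ ih₂ => exact ⟨ih₁, ih₂⟩
  | all s n φ => trivial

theorem Term.All.exists_bvars {P : ∀ s, Ref A s → Prop} {s : A.sig.Srt} {t : ATerm A s}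
    (ht : t.All P) : ∃ l : List (A.sig.Srt × ℕ),
      t.All fun s r => P s r ∧ ∀ m, r = (.bvar m : Ref A s) → (s, m) ∈ l := by
  induction t with
  | @var s r =>
    cases r with
    | bvar n => exact ⟨[(s, n)], ht, fun m hm => by cases hm; exact List.mem_singleton_self _⟩
    | avar x => exact ⟨[], ht, fun m hm => by cases hm⟩
    | read a n => exact ⟨[], ht, fun m hm => by cases hm⟩
  | cst c => exact ⟨[], trivial⟩
  | app f u ih => exact ih ht

/-- The individual variables of basic sort in a formula are finitely many. -/
theorem QF.All.exists_bvars {P : ∀ s, Ref A s → Prop} {Q : A.ASort → ℕ → Prop} {c : QF A}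
    (hc : c.All P Q) : ∃ l : List (A.sig.Srt × ℕ),
      c.All (fun s r => P s r ∧ ∀ m, r = (.bvar m : Ref A s) → (s, m) ∈ l) Q := by
  induction c with
  | tru => exact ⟨[], trivial⟩
  | eq t u =>
    obtain ⟨l₁, h₁⟩ := hc.1.exists_bvars
    obtain ⟨l₂, h₂⟩ := hc.2.exists_bvars
    exact ⟨l₁ ++ l₂,
      h₁.mono fun s r h => ⟨h.1, fun m hm => List.mem_append_left _ (h.2 m hm)⟩,
      h₂.mono fun s r h => ⟨h.1, fun m hm => List.mem_append_right _ (h.2 m hm)⟩⟩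
  | aeq E n m => exact ⟨[], hc⟩
  | neg φ ih => exact ih hc
  | and φ ψ ih₁ ih₂ =>
    obtain ⟨l₁, h₁⟩ := ih₁ hc.1
    obtain ⟨l₂, h₂⟩ := ih₂ hc.2
    exact ⟨l₁ ++ l₂,
      h₁.mono (fun s r h => ⟨h.1, fun m hm => List.mem_append_left _ (h.2 m hm)⟩) fun _ _ h => h,
      h₂.mono (fun s r h => ⟨h.1, fun m hm => List.mem_append_right _ (h.2 m hm)⟩) fun _ _ h => h⟩

open Classical in
/-- The read at the variable `n` of sort `E` that has the given name. -/
noncomputable def readNamed (enc : (Σ E s, A.Comp E s) → ℕ) (E : A.ASort) (n : ℕ)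
    (s : A.sig.Srt) (k : ℕ) : ATerm A s :=
  if h : ∃ a : A.Comp E s, 2 * enc ⟨E, s, a⟩ = k then .var (.read h.choose n)
  else .cst (A.sig.undef s)

theorem readNamed_name {enc : (Σ E s, A.Comp E s) → ℕ} (henc : Function.Injective enc)
    {E : A.ASort} {n : ℕ} {s : A.sig.Srt} (a : A.Comp E s) :
    readNamed enc E n s (2 * enc ⟨E, s, a⟩) = .var (.read a n) := by
  have h : ∃ b : A.Comp E s, 2 * enc ⟨E, s, b⟩ = 2 * enc ⟨E, s, a⟩ := ⟨a, rfl⟩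
  have ha : h.choose = a := by
    have := henc (Nat.eq_of_mul_eq_mul_left two_pos h.choose_spec)
    simpa using this
  rw [readNamed, dif_pos h, ha]

/-- Elimination of the quantifiers over basic sorts from a formula about a single entry. -/
theorem IsModelCompletion.exists_onlyEntry {Tstar : Set (FO A.sig)}
    (hT : IsModelCompletion A.sig Tstar) (s₀ : A.sig.Srt) {E : A.ASort} {n : ℕ} {c : QF A}
    (hc : c.All (fun s r => (∃ a : A.Comp E s, r = .read a n) ∨ ∃ m, r = .bvar m)
      (fun E' n' => E' = E ∧ n' = n)) :
    ∃ γ : QF A, γ.OnlyEntry E n ∧ ∀ M : Str A, M.base.Models Tstar →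
      ∀ (α : Asg M) (ρ : AEnv M) (v : BEnv M), γ.Holds α ρ v ↔ ∃ w, c.Holds α ρ w := by
  classical
  have := A.finComp
  obtain ⟨enc, henc⟩ := exists_injective_nat (Σ E s, A.Comp E s)
  obtain ⟨l, hl⟩ := hc.exists_bvars
  let L : List (A.sig.Srt × ℕ) := l.map fun p => (p.1, 2 * p.2 + 1)
  have heven : ∀ s k, (s, 2 * k) ∉ L := by
    intro s k h
    obtain ⟨p, -, hp⟩ := List.mem_map.1 h
    have := congrArg Prod.snd hp
    simp only at this
    omega
  have hQ : ∀ E' n' m', (E' = E ∧ n' = n) → (E' = E ∧ m' = n) → n' = m' :=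
    fun _ _ _ h h' => h.2.trans h'.2.symm
  obtain ⟨ψ, hψ, hψ'⟩ := hT.qe (FO.exs L (c.toFO enc s₀))
  refine ⟨ψ.toQF (readNamed enc E n), FO.all_toQF (fun s k => ?_) ψ, fun M hM α ρ v => ?_⟩
  · unfold readNamed
    split_ifs with h
    · exact ⟨_, rfl⟩
    · trivial
  rw [FO.holds_toQF hψ, hψ' _ hM, FO.holds_exs]
  constructor
  · rintro ⟨w, hw, h⟩
    refine ⟨fun s m => w s (2 * m + 1), (QF.holds_toFO hQ (fun s r hr => ?_) hc).1 h⟩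
    rcases hr with ⟨a, rfl⟩ | ⟨m, rfl⟩
    · simp only [Ref.name]
      rw [hw _ _ (heven _ _), readNamed_name henc]
      rfl
    · rfl
  · rintro ⟨b, h⟩
    refine ⟨fun s k => if (s, k) ∈ L then b s (k / 2) else
      (readNamed enc E n s k).eval M.base (Ref.eval α ρ v), fun s k hk => if_neg hk,
      (QF.holds_toFO hQ (fun s r hr => ?_) hl).2 h⟩
    rcases hr with ⟨⟨a, rfl⟩ | ⟨m, rfl⟩, hr⟩
    · refine (if_neg (heven _ _)).trans ?_
      simp only [Ref.name]
      rw [readNamed_name henc]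
      rfl
    · have : (2 * m + 1) / 2 = m := by omega
      exact (if_pos (List.mem_map.2 ⟨(s, m), hr m rfl, rfl⟩)).trans (congrArg (b s) this)

end QuantifierElimination

section LocallyDefinable

variable {A : Setting}

/-- The predicate on assignments and index environments is defined, modulo `Tstar`, by the matrix of
a strongly local formula. -/
def LocallyDefinable (Tstar : Set (FO A.sig)) (P : ∀ M : Str A, Asg M → AEnv M → Prop) : Prop :=
  ∃ φ : EFormula A, StronglyLocal φ ∧ ∀ M : Str A, M.base.Models Tstar →
    ∀ (α : Asg M) (ρ : AEnv M) (v : BEnv M), P M α ρ ↔ ∃ d ∈ φ, ∀ c ∈ d, c.Holds α ρ v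

variable {Tstar : Set (FO A.sig)} {P P' : ∀ M : Str A, Asg M → AEnv M → Prop}

theorem QF.IsLocal.locallyDefinable {c : QF A} (hc : c.IsLocal)
    (h : ∀ M : Str A, M.base.Models Tstar → ∀ (α : Asg M) (ρ : AEnv M) (v : BEnv M),
      P M α ρ ↔ c.Holds α ρ v) : LocallyDefinable Tstar P :=
  ⟨[[c]], stronglyLocal_iff.2 (by simpa using hc), fun M hM α ρ v => by simpa using h M hM α ρ v⟩

theorem LocallyDefinable.congr (h : LocallyDefinable Tstar P)
    (hP : ∀ (M : Str A) (α : Asg M) (ρ : AEnv M), P M α ρ ↔ P' M α ρ) : LocallyDefinable Tstar P' := by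
  obtain ⟨φ, hφ, h⟩ := h
  exact ⟨φ, hφ, fun M hM α ρ v => (hP M α ρ).symm.trans (h M hM α ρ v)⟩

theorem LocallyDefinable.and (h : LocallyDefinable Tstar P) (h' : LocallyDefinable Tstar P') :
    LocallyDefinable Tstar fun M α ρ => P M α ρ ∧ P' M α ρ := by
  obtain ⟨φ, hφ, h⟩ := h
  obtain ⟨φ', hφ', h'⟩ := h'
  refine ⟨φ.flatMap fun d => φ'.map (d ++ ·), stronglyLocal_iff.2 fun d hd c hc => ?_,
    fun M hM α ρ v => ?_⟩
  · obtain ⟨d₁, hd₁, hd⟩ := List.mem_flatMap.1 hd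
    obtain ⟨d₂, hd₂, rfl⟩ := List.mem_map.1 hd
    exact (List.mem_append.1 hc).elim (hφ.2 d₁ hd₁ c) (hφ'.2 d₂ hd₂ c)
  · dsimp only
    rw [h M hM α ρ v, h' M hM α ρ v]
    constructor
    · rintro ⟨⟨d₁, hd₁, h₁⟩, d₂, hd₂, h₂⟩
      exact ⟨d₁ ++ d₂, List.mem_flatMap.2 ⟨d₁, hd₁, List.mem_map_of_mem hd₂⟩,
        fun c hc => (List.mem_append.1 hc).elim (h₁ c) (h₂ c)⟩
    · rintro ⟨d, hd, hc⟩
      obtain ⟨d₁, hd₁, hd⟩ := List.mem_flatMap.1 hd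
      obtain ⟨d₂, hd₂, rfl⟩ := List.mem_map.1 hd
      exact ⟨⟨d₁, hd₁, fun c h => hc c (List.mem_append_left _ h)⟩, d₂, hd₂,
        fun c h => hc c (List.mem_append_right _ h)⟩

theorem LocallyDefinable.or (h : LocallyDefinable Tstar P) (h' : LocallyDefinable Tstar P') :
    LocallyDefinable Tstar fun M α ρ => P M α ρ ∨ P' M α ρ := by
  obtain ⟨φ, hφ, h⟩ := h
  obtain ⟨φ', hφ', h'⟩ := h'
  refine ⟨φ ++ φ', stronglyLocal_iff.2 fun d hd => (List.mem_append.1 hd).elim (hφ.2 d) (hφ'.2 d),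
    fun M hM α ρ v => ?_⟩
  dsimp only
  rw [h M hM α ρ v, h' M hM α ρ v]
  simp only [List.mem_append, or_and_right, exists_or]

theorem LocallyDefinable.ball {ι : Type} {P : ι → ∀ M : Str A, Asg M → AEnv M → Prop}
    (l : List ι) (h : ∀ i ∈ l, LocallyDefinable Tstar (P i)) :
    LocallyDefinable Tstar fun M α ρ => ∀ i ∈ l, P i M α ρ := by
  induction l with
  | nil => exact ⟨[[]], stronglyLocal_iff.2 (by simp), by simp⟩
  | cons i l ih =>
    refine ((h i List.mem_cons_self).and
      (ih fun j hj => h j (List.mem_cons_of_mem _ hj))).congr fun M α ρ => ?_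
    rw [List.forall_mem_cons]

theorem LocallyDefinable.bex {ι : Type} {P : ι → ∀ M : Str A, Asg M → AEnv M → Prop}
    (l : List ι) (h : ∀ i ∈ l, LocallyDefinable Tstar (P i)) :
    LocallyDefinable Tstar fun M α ρ => ∃ i ∈ l, P i M α ρ := by
  induction l with
  | nil => exact ⟨[], stronglyLocal_iff.2 (by simp), by simp⟩
  | cons i l ih =>
    refine ((h i List.mem_cons_self).or
      (ih fun j hj => h j (List.mem_cons_of_mem _ hj))).congr fun M α ρ => ?_
    rw [List.exists_mem_cons_iff]

theorem LocallyDefinable.exists_stronglyLocal (h : LocallyDefinable Tstar P) :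
    ∃ φ : EFormula A, StronglyLocal φ ∧ ∀ M : Str A, M.base.Models Tstar →
      ∀ α : Asg M, φ.Holds α ↔ ∃ ρ : AEnv M, P M α ρ := by
  obtain ⟨φ, hφ, h⟩ := h
  refine ⟨φ, hφ, fun M hM α => ⟨?_, ?_⟩⟩
  · rintro ⟨d, hd, ρ, v, hc⟩
    exact ⟨ρ, (h M hM α ρ v).2 ⟨d, hd, hc⟩⟩
  · rintro ⟨ρ, hρ⟩
    obtain ⟨d, hd, hc⟩ := (h M hM α ρ fun s _ => M.base.cn (A.sig.undef s)).1 hρ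
    exact ⟨d, hd, ρ, _, hc⟩

/-- Substitution of terms for the references and renaming of the variables of artifact sort. -/
def QF.map (f : ∀ s, Ref A s → ATerm A s) (g : ℕ → ℕ) : QF A → QF A
  | .tru => .tru
  | .eq t u => .eq (t.subst f) (u.subst f)
  | .aeq E n m => .aeq E (g n) (g m)
  | .neg φ => .neg (φ.map f g)
  | .and φ ψ => .and (φ.map f g) (ψ.map f g)

theorem QF.holds_map {f : ∀ s, Ref A s → ATerm A s} {g : ℕ → ℕ} {P : ∀ s, Ref A s → Prop}
    {Q : A.ASort → ℕ → Prop} {M : Str A} {α α' : Asg M} {ρ ρ' : AEnv M} {v v' : BEnv M}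
    (hf : ∀ s r, P s r → (f s r).eval M.base (Ref.eval α ρ v) = Ref.eval α' ρ' v' s r)
    (hg : ∀ E n, ρ' E n = ρ E (g n)) {c : QF A} (hc : c.All P Q) :
    (c.map f g).Holds α ρ v ↔ c.Holds α' ρ' v' := by
  induction c with
  | tru => exact Iff.rfl
  | eq t u =>
    simp only [QF.map, QF.Holds, Term.eval_subst]
    rw [Term.eval_congr M.base hf hc.1, Term.eval_congr M.base hf hc.2]
  | aeq E n m => simp only [QF.map, QF.Holds, hg]
  | neg φ ih => exact not_congr (ih hc)
  | and φ ψ ih₁ ih₂ => exact and_congr (ih₁ hc.1) (ih₂ hc.2)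

theorem QF.All.map {f : ∀ s, Ref A s → ATerm A s} {g : ℕ → ℕ} {P P' : ∀ s, Ref A s → Prop}
    {Q Q' : A.ASort → ℕ → Prop} (hf : ∀ s r, P s r → (f s r).All P')
    (hg : ∀ E n, Q E n → Q' E (g n)) {c : QF A} (hc : c.All P Q) : (c.map f g).All P' Q' := by
  induction c with
  | tru => trivial
  | eq t u => exact ⟨Term.all_subst hf hc.1, Term.all_subst hf hc.2⟩
  | aeq E n m => exact ⟨hg _ _ hc.1, hg _ _ hc.2⟩
  | neg φ ih => exact ih hc
  | and φ ψ ih₁ ih₂ => exact ⟨ih₁ hc.1, ih₂ hc.2⟩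

theorem QF.NoBasicVar.holds_congr {M : Str A} {α : Asg M} {ρ : AEnv M} {c : QF A}
    (hc : c.NoBasicVar) (v v' : BEnv M) : c.Holds α ρ v ↔ c.Holds α ρ v' := by
  have key : ∀ s r, (∀ n, r ≠ (.bvar n : Ref A s)) →
      Ref.eval α ρ v s r = Ref.eval α ρ v' s r := by
    intro s r hr
    cases r with
    | avar x => rfl
    | bvar n => exact (hr n rfl).elim
    | read a n => rfl
  induction c with
  | tru => exact Iff.rfl
  | eq t u =>
    simp only [QF.Holds]
    rw [Term.eval_congr M.base key hc.1, Term.eval_congr M.base key hc.2]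
  | aeq E n m => exact Iff.rfl
  | neg φ ih => exact not_congr (ih hc)
  | and φ ψ ih₁ ih₂ => exact and_congr (ih₁ hc.1) (ih₂ hc.2)

theorem QF.holds_conj {M : Str A} {α : Asg M} {ρ : AEnv M} {v : BEnv M} (l : List (QF A)) :
    (QF.conj l).Holds α ρ v ↔ ∀ c ∈ l, c.Holds α ρ v := by
  induction l with
  | nil => simp [QF.conj, QF.Holds]
  | cons c l ih => simp [QF.conj, QF.Holds, ih]

end LocallyDefinable

section ControlFlow

variable {D : DataSchema} {B : Type} [Finite B]

open Classical in
/-- The assignment after the control-flow rule has fired for the case `e`. -/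
noncomputable def CRule.next (r : CRule D B) {M : Str (D.setting B)} (α : Asg M)
    (e : M.art ASrt.pi) : Asg M where
  x := fun x => x.elim
  a := fun {_ _} a => match a with
    | .cv x => α.a (DComp.cv x)
    | .ctl c => fun y => match r.upd.find? (fun p => p.1 = c) with
      | some p => if y = e then M.base.cn (BConst.life p.2) else α.a (DComp.ctl c) y
      | none => α.a (DComp.ctl c) y
    | .rep R k => α.a (DComp.rep R k)

theorem eval_readHere {M : Str (D.setting B)} (α : Asg M) (ρ : AEnv M) (v : BEnv M) {E : ASrt D}
    {s : BSort D} (a : DComp D B E s) (y : M.art E) :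
    (readHere a).eval α (ρ.bind E y) v = α.a a y := by
  simp [readHere, CTerm.eval, Term.eval, Ref.eval, AEnv.bind]

open Classical in
theorem eval_writeAt {M : Str (D.setting B)} (α : Asg M) (ρ : AEnv M) (v : BEnv M) {E : ASrt D}
    {s : BSort D} (a : DComp D B E s) (u : ATerm (D.setting B) s) (y : M.art E) :
    (writeAt a u).eval α (ρ.bind E y) v =
      if y = ρ E 1 then u.eval M.base (Ref.eval α (ρ.bind E y) v) else α.a a y := by
  have h0 : ρ.bind E y E 0 = y := by simp [AEnv.bind]
  have h1 : ρ.bind E y E 1 = ρ E 1 := by simp [AEnv.bind]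
  simp only [writeAt, CTerm.eval, QF.Holds, h0, h1, eval_readHere]

theorem CRule.eval_updA (r : CRule D B) {M : Str (D.setting B)} (α : Asg M) (ρ : AEnv M)
    (v : BEnv M) {E : ASrt D} {s : BSort D} (a : DComp D B E s) (y : M.art E) :
    (r.tr.updA a).eval α (ρ.bind E y) v = (r.next α (ρ ASrt.pi 1)).a a y := by
  cases a with
  | cv x => exact eval_readHere α ρ v _ y
  | rep R k => exact eval_readHere α ρ v _ y
  | ctl c =>
    simp only [CRule.tr, CRule.next, ctrlUpd]
    cases r.upd.find? _ with
    | none => exact eval_readHere α ρ v _ y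
    | some p => exact eval_writeAt α ρ v _ _ y

theorem CRule.holds_tr_iff (r : CRule D B) {M : Str (D.setting B)} (α α' : Asg M) :
    r.tr.Holds α α' ↔ ∃ (ρ : AEnv M) (v : BEnv M),
      (∀ c ∈ r.tr.guard, c.Holds α ρ v) ∧ α' = r.next α (ρ ASrt.pi 1) := by
  refine exists_congr fun ρ => exists_congr fun v => and_congr_right fun _ => ⟨?_, ?_⟩
  · rintro ⟨-, h⟩
    cases α' with
    | mk x a =>
      have h₁ : (fun {s} => x (s := s)) = fun {s} => (r.next α (ρ ASrt.pi 1)).x (s := s) := by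
        funext s y
        exact y.elim
      have h₂ : (fun {E s} => a (E := E) (s := s)) =
          fun {E s} => (r.next α (ρ ASrt.pi 1)).a (E := E) (s := s) := by
        funext E s b y
        exact (h E s b y).trans (r.eval_updA α ρ v b y)
      exact congrArg₂ Asg.mk h₁ h₂
  · rintro rfl
    exact ⟨fun s x => x.elim, fun E s a y => (r.eval_updA α ρ v a y).symm⟩

theorem Cond.all_tr {P : ∀ s, Ref (D.setting B) s → Prop} {Q : ASrt D → ℕ → Prop} {i : ℕ}
    {σ : Sub D B} (hσ : ∀ t n, P _ (σ t n)) (hc : ∀ (s : BSort D) (c : DComp D B .pi s),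
      P s (.read (A := D.setting B) (E := ASrt.pi) c i)) (φ : Cond D B) : (φ.tr i σ).All P Q := by
  induction φ with
  | eq t u => exact ⟨t.all_tr (fun _ _ => hσ _ _) (.inr hc), u.all_tr (fun _ _ => hσ _ _) (.inr hc)⟩
  | neg φ ih => exact ih
  | and φ ψ ih₁ ih₂ => exact ⟨ih₁, ih₂⟩

theorem CRule.all_guard (r : CRule D B) {Q : ASrt D → ℕ → Prop} :
    (QF.conj r.tr.guard).All (fun s x => (∃ a : DComp D B .pi s,
      x = .read (A := D.setting B) (E := ASrt.pi) a 1) ∨ ∃ m, x = .bvar m) Q := by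
  refine QF.all_conj _ fun c hc => ?_
  rcases List.mem_append.1 hc with hc | hc
  · obtain ⟨p, -, rfl⟩ := List.mem_map.1 hc
    exact ⟨Or.inl ⟨_, rfl⟩, trivial⟩
  · obtain ⟨φ, -, rfl⟩ := List.mem_map.1 hc
    exact φ.all_tr (fun t n => Or.inr ⟨n, rfl⟩) fun s c => Or.inl ⟨c, rfl⟩

/-- Renaming that keeps the index variables `0` and `1` free. -/
def shiftRef {A : Setting} : ∀ s, Ref A s → ATerm A s
  | _, .avar x => .var (.avar x)
  | _, .bvar n => .var (.bvar n)
  | _, .read a n => .var (.read a (n + 2))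

open Classical in
/-- The value of a reference at the case index updated by the rule. -/
noncomputable def CRule.updRef (r : CRule D B) :
    ∀ s, Ref (D.setting B) s → ATerm (D.setting B) s
  | _, .avar x => .var (.avar x)
  | _, .bvar n => .var (.bvar n)
  | _, .read a n => match a with
    | .cv x => .var (.read (A := D.setting B) (DComp.cv x) (n + 2))
    | .ctl c => match r.upd.find? (fun p => p.1 = c) with
      | some p => .cst (BConst.life p.2)
      | none => .var (.read (A := D.setting B) (DComp.ctl c) (n + 2))
    | .rep R k => .var (.read (A := D.setting B) (DComp.rep R k) (n + 2))

/-- The environment of the variables renamed by `shiftRef`. -/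
def AEnv.shift {A : Setting} {M : Str A} (ρ : AEnv M) : AEnv M := fun E n => ρ E (n + 2)

variable {Tstar : Set (FO D.sig)}

theorem QF.IsLocal.locallyDefinable_next (r : CRule D B) {c : QF (D.setting B)} (hc : c.IsLocal) :
    LocallyDefinable (A := D.setting B) Tstar fun _ α ρ =>
      ∀ v, c.Holds (r.next α (ρ ASrt.pi 1)) ρ.shift v := by
  have hv : ∀ {M : Str (D.setting B)} {α : Asg M} {ρ : AEnv M} (v : BEnv M),
      (∀ w, c.Holds (r.next α (ρ ASrt.pi 1)) ρ.shift w) ↔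
        c.Holds (r.next α (ρ ASrt.pi 1)) ρ.shift v := fun v =>
    ⟨fun h => h v, fun h w => (hc.noBasicVar.holds_congr v w).1 h⟩
  rcases hc with ⟨E, n, m, rfl | rfl⟩ | hc | ⟨E, n, hc⟩
  · exact QF.IsLocal.locallyDefinable (c := .aeq E (n + 2) (m + 2))
      (Or.inl ⟨_, _, _, Or.inl rfl⟩) fun M _ α ρ v => hv v
  · exact QF.IsLocal.locallyDefinable (c := .neg (.aeq E (n + 2) (m + 2)))
      (Or.inl ⟨_, _, _, Or.inr rfl⟩) fun M _ α ρ v => hv v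
  · refine QF.IsLocal.locallyDefinable (c := c.map shiftRef (· + 2))
      (Or.inr (Or.inl (QF.All.map (g := (· + 2)) ?_ (fun _ _ h => h) hc))) fun M _ α ρ v =>
        (hv v).trans (QF.holds_map (g := (· + 2)) (fun s x hx => ?_) (fun _ _ => rfl) hc).symm
    · rintro s _ ⟨x, rfl⟩
      exact x.elim
    · obtain ⟨x, rfl⟩ := hx
      exact x.elim
  · have hshift : (c.map shiftRef (· + 2)).IsLocal := by
      refine Or.inr (Or.inr ⟨E, n + 2, QF.All.map ?_ ?_ hc⟩)
      · rintro s _ ⟨a, rfl⟩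
        exact ⟨a, rfl⟩
      · rintro _ _ ⟨rfl, rfl⟩
        exact ⟨rfl, rfl⟩
    cases E with
    | repo R =>
      refine hshift.locallyDefinable fun M _ α ρ v =>
        (hv v).trans (QF.holds_map (g := (· + 2)) (fun s x hx => ?_) (fun _ _ => rfl) hc).symm
      obtain ⟨a, rfl⟩ := hx
      cases a
      rfl
    | pi =>
      have hupd : (c.map r.updRef (· + 2)).IsLocal := by
        refine Or.inr (Or.inr ⟨ASrt.pi, n + 2, QF.All.map ?_ ?_ hc⟩)
        · rintro s _ ⟨a, rfl⟩
          cases a with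
          | cv x => exact ⟨_, rfl⟩
          | ctl c =>
            simp only [CRule.updRef]
            cases r.upd.find? _ with
            | none => exact ⟨_, rfl⟩
            | some p => trivial
        · rintro _ _ ⟨rfl, rfl⟩
          exact ⟨rfl, rfl⟩
      have heq : (QF.aeq (A := D.setting B) ASrt.pi (n + 2) 1).IsLocal :=
        Or.inl ⟨_, _, _, Or.inl rfl⟩
      have hne : (QF.neg (.aeq (A := D.setting B) ASrt.pi (n + 2) 1)).IsLocal :=
        Or.inl ⟨_, _, _, Or.inr rfl⟩
      have hdef : ∀ {c : QF (D.setting B)}, c.IsLocal →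
          LocallyDefinable (A := D.setting B) Tstar fun _ α ρ => ∀ v, c.Holds α ρ v :=
        fun hc => hc.locallyDefinable fun M _ α ρ v =>
          ⟨fun h => h v, fun h w => (hc.noBasicVar.holds_congr v w).1 h⟩
      refine (((hdef heq).and (hdef hupd)).or ((hdef hne).and (hdef hshift))).congr
        fun M α ρ => ?_
      have v₀ : BEnv M := fun s _ => M.base.cn (BConst.undef s)
      have hw : ∀ {c : QF (D.setting B)}, c.IsLocal →
          ((∀ v, c.Holds α ρ v) ↔ c.Holds α ρ v₀) := fun hc =>
        ⟨fun h => h v₀, fun h w => (hc.noBasicVar.holds_congr v₀ w).1 h⟩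
      rw [hw heq, hw hne, hw hupd, hw hshift, hv v₀]
      by_cases he : ρ ASrt.pi (n + 2) = ρ ASrt.pi 1
      · have : (c.map r.updRef (· + 2)).Holds α ρ v₀ ↔
            c.Holds (r.next α (ρ ASrt.pi 1)) ρ.shift v₀ := by
          refine QF.holds_map (g := (· + 2)) (fun s x hx => ?_) (fun _ _ => rfl) hc
          obtain ⟨a, rfl⟩ := hx
          cases a with
          | cv x => rfl
          | ctl c =>
            simp only [CRule.updRef, Ref.eval, CRule.next]
            cases r.upd.find? _ with
            | none => rfl
            | some p => exact (if_pos he).symm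
        rw [← this]
        simp [QF.Holds, he]
      · have : (c.map shiftRef (· + 2)).Holds α ρ v₀ ↔
            c.Holds (r.next α (ρ ASrt.pi 1)) ρ.shift v₀ := by
          refine QF.holds_map (g := (· + 2)) (fun s x hx => ?_) (fun _ _ => rfl) hc
          obtain ⟨a, rfl⟩ := hx
          cases a with
          | cv x => rfl
          | ctl c =>
            simp only [Ref.eval, CRule.next]
            cases r.upd.find? _ with
            | none => rfl
            | some p => exact (if_neg he).symm
        rw [← this]
        simp [QF.Holds, he]

/-- Control-flow transitions are strongly local. -/
theorem CRule.stronglyLocalTrans (hT : IsModelCompletion D.sig Tstar) (r : CRule D B) :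
    StronglyLocalTrans (A := D.setting B) Tstar r.tr := by
  intro ψ hψ
  obtain ⟨γ, hγ, hγ'⟩ := IsModelCompletion.exists_onlyEntry (A := D.setting B) hT BSort.ctrl
    (E := ASrt.pi) (n := 1) r.all_guard
  have hguard : LocallyDefinable (A := D.setting B) Tstar fun _ α ρ =>
      ∃ v, (QF.conj r.tr.guard).Holds α ρ v :=
    QF.IsLocal.locallyDefinable (Or.inr (Or.inr ⟨_, _, hγ⟩)) fun M hM α ρ v =>
      (hγ' M hM α ρ v).symm
  have hpost : LocallyDefinable (A := D.setting B) Tstar fun _ α ρ =>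
      ∃ d ∈ ψ, ∀ c ∈ d, ∀ v, c.Holds (r.next α (ρ ASrt.pi 1)) ρ.shift v :=
    .bex ψ fun d hd => .ball d fun c hc => QF.IsLocal.locallyDefinable_next r (hψ.2 d hd c hc)
  obtain ⟨φ, hφ, hφ'⟩ := (hguard.and hpost).exists_stronglyLocal
  refine ⟨φ, hφ, fun M hM α => (hφ' M hM α).trans ⟨?_, ?_⟩⟩
  · rintro ⟨ρ, ⟨v, hg⟩, d, hd, hc⟩
    exact ⟨_, ⟨_, List.mem_singleton_self _, (r.holds_tr_iff _ _).2
      ⟨ρ, v, (QF.holds_conj _).1 hg, rfl⟩⟩, d, hd, ρ.shift, v, fun c h => hc c h v⟩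
  · rintro ⟨α', ⟨τ, hτ, hτα⟩, d, hd, ρ', v', hc⟩
    obtain rfl := List.mem_singleton.1 hτ
    obtain ⟨ρ, v, hg, rfl⟩ := (r.holds_tr_iff _ _).1 hτα
    let ρ'' : AEnv M := fun E n => match n with
      | 0 => ρ E 0
      | 1 => ρ E 1
      | n + 2 => ρ' E n
    have hg' : ∃ w, (QF.conj r.tr.guard).Holds α ρ'' w := by
      rw [← hγ' M hM α ρ'' v]
      have hρ : entryType α (ρ ASrt.pi 1) = entryType α (ρ'' ASrt.pi 1) := rfl
      exact (hγ.holds_iff hρ).1 ((hγ' M hM α ρ v).2 ⟨v, (QF.holds_conj _).2 hg⟩)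
    exact ⟨ρ'', hg', d, hd, fun c h w =>
      ((hψ.1 d hd c h).holds_congr v' w).1 (hc c h)⟩

end ControlFlow

end DAB

theorem separated_query_translation_strongly_local_and_backreach_terminates
    (M : DABModel) (P : M.Property) (hP : P.Separated) :
    DAB.StronglyLocal (M.translate P) ∧
      ∀ Tstar : Set (DAB.FO M.D.sig), DAB.IsModelCompletion M.D.sig Tstar →
        M.D.sig.Acyclic →
        (∀ τ ∈ M.updateTransitions, DAB.StronglyLocalTrans Tstar τ) →
        DAB.BackReachTerminates M.toRAS Tstar (M.translate P) := by
  have hlocal := M.stronglyLocal_translate P hP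
  refine ⟨hlocal, fun Tstar hT hS hupd => ?_⟩
  refine DAB.backReachTerminates_of_stronglyLocal M.toRAS hT hS (fun τ hτ => ?_) hlocal
  rcases List.mem_append.1 hτ with hτ | hτ
  · obtain ⟨r, -, rfl⟩ := List.mem_map.1 hτ
    exact r.stronglyLocalTrans hT
  · exact hupd τ hτ
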